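/- arXiv:math/0703584 — 2 statements merged into one kernel-verified Lean document; each statement's English description precedes it below -/
import Mathlib

section
/- The functional F^{1/n} is concave on 𝒞: for all h₀, h₁ ∈ 𝒞 and all t ∈ [0,1], F^{1/n}((1-t)h₀ + t h₁) ≥ (1-t) F^{1/n}(h₀) + t F^{1/n}(h₁). -/
open MeasureTheory Metric
open scoped RealInnerProductSpace ENNReal

noncomputable section

/-- Euclidean `n`-space. -/
abbrev E (n : ℕ) : Type := EuclideanSpace ℝ (Fin n)

/-- Orthogonal projection onto the tangent space `u^⊥` of the sphere at a unit vector `u`. -/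
noncomputable def tproj {n : ℕ} (u : E n) : E n →L[ℝ] E n :=
  ContinuousLinearMap.id ℝ (E n) - (innerSL ℝ u).smulRight u

/-- The second derivative of `h` at `u` as an endomorphism of `ℝⁿ`.  For a function on the
sphere, identified with its `1`-homogeneous extension, its restriction to the tangent space
`u^⊥` is represented in any orthonormal frame by the matrix `(h_ij + h δ_ij)`. -/
noncomputable def sHess {n : ℕ} (h : E n → ℝ) (u : E n) : E n →L[ℝ] E n :=
  fderiv ℝ (gradient h) u

/-- `det(h_ij + h δ_ij)(u)`: the determinant of the restriction of `sHess h u` to the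
tangent space `u^⊥`. -/
noncomputable def sdet {n : ℕ} (h : E n → ℝ) (u : E n) : ℝ :=
  LinearMap.det
    (((tproj u).comp ((sHess h u).comp (tproj u)) + (innerSL ℝ u).smulRight u :
      E n →L[ℝ] E n) : E n →ₗ[ℝ] E n)

/-- Positive `1`-homogeneity; functions on the sphere are identified with their
`1`-homogeneous extensions. -/
def homog1 {n : ℕ} (h : E n → ℝ) : Prop := ∀ t : ℝ, 0 < t → ∀ x : E n, h (t • x) = t * h x

/-- `h ∈ 𝒞`: (the `1`-homogeneous extension of) a function of class `C²` on the sphere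
such that the matrix `(h_ij + h δ_ij)` is positive definite at every point of the sphere. -/
def memC (n : ℕ) (h : E n → ℝ) : Prop :=
  homog1 h ∧ ContDiffOn ℝ 2 h {(0 : E n)}ᶜ ∧
    ∀ u ∈ sphere (0 : E n) 1, ∀ v ∈ (ℝ ∙ u)ᗮ, v ≠ 0 → 0 < ⟪sHess h u v, v⟫

/-- The volume functional `F(h) = (1/n) ∫_{S^{n-1}} h det(h_ij + h δ_ij) dℋ^{n-1}`. -/
noncomputable def volF (n : ℕ) (h : E n → ℝ) : ℝ :=
  (1 / n : ℝ) * ∫ u in sphere (0 : E n) 1, h u * sdet h u ∂μH[(n : ℝ) - 1]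

open scoped Pointwise

/-- The one-dimensional Brunn-Minkowski inequality. -/
theorem Real.volume_add_volume_le_of_add_mem {A B C : Set ℝ} (hA : MeasurableSet A)
    (hB : MeasurableSet B) (hA₀ : A.Nonempty) (hB₀ : B.Nonempty)
    (h : ∀ a ∈ A, ∀ b ∈ B, a + b ∈ C) : volume A + volume B ≤ volume C := by
  have key : ∀ K ⊆ A, IsCompact K → ∀ L ⊆ B, IsCompact L → K.Nonempty → L.Nonempty →
      volume K + volume L ≤ volume C := by
    intro K hKA hK L hLB hL hK₀ hL₀
    obtain ⟨a, haK, ha⟩ := hK.exists_isGreatest hK₀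
    obtain ⟨b, hbL, hb⟩ := hL.exists_isLeast hL₀
    have h1 : volume ((fun x => x + b) '' K) = volume K := by simp
    have h2 : volume ((fun x => a + x) '' L) = volume L := by simp
    have hdisj : AEDisjoint volume ((fun x => x + b) '' K) ((fun x => a + x) '' L) := by
      refine measure_mono_null (t := {a + b}) ?_ (by simp)
      rintro _ ⟨⟨x, hx, rfl⟩, ⟨y, hy, hxy⟩⟩
      have := ha hx
      have := hb hy
      simp only [Set.mem_singleton_iff] at hxy ⊢
      linarith
    rw [← h1, ← h2, ← measure_union₀ (hL.image (by fun_prop)).measurableSet.nullMeasurableSet hdisj]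
    refine measure_mono ?_
    rintro _ (⟨x, hx, rfl⟩ | ⟨x, hx, rfl⟩)
    · exact h _ (hKA hx) _ (hLB hbL)
    · exact h _ (hKA haK) _ (hLB hx)
  obtain ⟨a₀, ha₀⟩ := hA₀
  obtain ⟨b₀, hb₀⟩ := hB₀
  have hK' : ∀ K ⊆ A, IsCompact K → ∀ L ⊆ B, IsCompact L → volume K + volume L ≤ volume C := by
    intro K hKA hK L hLB hL
    refine le_trans (add_le_add (measure_mono (Set.subset_insert a₀ K))
      (measure_mono (Set.subset_insert b₀ L))) ?_
    exact key _ (Set.insert_subset ha₀ hKA) (hK.insert a₀) _ (Set.insert_subset hb₀ hLB)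
      (hL.insert b₀) (Set.insert_nonempty _ _) (Set.insert_nonempty _ _)
  rw [hA.measure_eq_iSup_isCompact, hB.measure_eq_iSup_isCompact]
  simp only [iSup_and']
  exact ENNReal.biSup_add_biSup_le' ⟨∅, by simp⟩ ⟨∅, by simp⟩
    fun K hK L hL => hK' K hK.1 hK.2 L hL.1 hL.2

theorem ENNReal.geom_mean_le_arith_mean2_weighted' {t : ℝ} (ht₀ : 0 < t) (ht₁ : t < 1)
    (a b : ℝ≥0∞) : a ^ (1 - t) * b ^ t ≤
      ENNReal.ofReal (1 - t) * a + ENNReal.ofReal t * b := by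
  have h1 : 0 < 1 - t := by linarith
  rcases eq_or_ne a ∞ with rfl | ha
  · simp [ENNReal.mul_top, h1.not_ge, ht₁]
  rcases eq_or_ne b ∞ with rfl | hb
  · simp [ENNReal.mul_top, ht₀]
  lift a to NNReal using ha
  lift b to NNReal using hb
  have := NNReal.geom_mean_le_arith_mean2_weighted (Real.toNNReal (1 - t)) (Real.toNNReal t) a b
    (by rw [← Real.toNNReal_add h1.le ht₀.le]; simp)
  rw [Real.coe_toNNReal _ h1.le, Real.coe_toNNReal _ ht₀.le] at this
  rw [← ENNReal.coe_rpow_of_nonneg _ h1.le, ← ENNReal.coe_rpow_of_nonneg _ ht₀.le]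
  rw [ENNReal.ofReal, ENNReal.ofReal]
  exact_mod_cast this

/-- The layer cake formula, truncated at height one. -/
theorem lintegral_min_one_eq_meas_lt {α : Type*} [MeasurableSpace α] (μ : Measure α)
    {f : α → ℝ≥0∞} (hf : Measurable f) :
    ∫⁻ x, min (f x) 1 ∂μ = ∫⁻ s in Set.Ioo (0 : ℝ) 1, μ {x | ENNReal.ofReal s < f x} := by
  have hfin : ∀ x, min (f x) 1 ≠ ∞ := fun x => ne_top_of_le_ne_top ENNReal.one_ne_top
    (min_le_right _ _)
  have h1 := lintegral_eq_lintegral_meas_lt μ (f := fun x => (min (f x) 1).toReal)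
    (Filter.Eventually.of_forall fun x => ENNReal.toReal_nonneg) (by fun_prop)
  simp only [ENNReal.ofReal_toReal (hfin _)] at h1
  rw [h1, ← Set.Ioo_union_Ici_eq_Ioi (zero_lt_one' ℝ),
    lintegral_union measurableSet_Ici (Set.disjoint_left.2 fun x hx hx' =>
      (not_lt.2 (Set.mem_Ici.1 hx')) hx.2)]
  have h2 : ∫⁻ s in Set.Ici (1 : ℝ), μ {x | s < (min (f x) 1).toReal} = 0 := by
    rw [setLIntegral_congr_fun (g := fun _ => 0) measurableSet_Ici]
    · simp
    · intro s hs
      have : {x | s < (min (f x) 1).toReal} = ∅ := by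
        ext x
        simp only [Set.mem_ofPred_eq, Set.mem_empty_iff_false, iff_false, not_lt]
        refine le_trans ?_ (Set.mem_Ici.1 hs)
        exact ENNReal.toReal_le_of_le_ofReal zero_le_one (by simp)
      simp [this]
  rw [h2, add_zero]
  refine setLIntegral_congr_fun measurableSet_Ioo fun s hs => ?_
  congr 1
  ext x
  simp only [Set.mem_ofPred_eq]
  rw [← ENNReal.ofReal_lt_iff_lt_toReal hs.1.le (hfin x), lt_min_iff]
  simp [hs.2]

theorem prekopa_leindler_real_of_le_one {t : ℝ} (ht₀ : 0 < t) (ht₁ : t < 1) {f g h : ℝ → ℝ≥0∞}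
    (hf : Measurable f) (hg : Measurable g) (hh : Measurable h)
    (hf₁ : ⨆ x, f x = 1) (hg₁ : ⨆ x, g x = 1)
    (H : ∀ x y, f x ^ (1 - t) * g y ^ t ≤ h ((1 - t) * x + t * y)) :
    (∫⁻ x, f x) ^ (1 - t) * (∫⁻ x, g x) ^ t ≤ ∫⁻ x, h x := by
  have h1 : 0 < 1 - t := by linarith
  have hf₂ : ∀ x, f x ≤ 1 := fun x => hf₁ ▸ le_iSup f x
  have hg₂ : ∀ x, g x ≤ 1 := fun x => hg₁ ▸ le_iSup g x
  refine (ENNReal.geom_mean_le_arith_mean2_weighted' ht₀ ht₁ _ _).trans ?_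
  have ef : ∫⁻ x, f x = ∫⁻ x, min (f x) 1 := by simp [hf₂]
  have eg : ∫⁻ x, g x = ∫⁻ x, min (g x) 1 := by simp [hg₂]
  have eh : ∫⁻ x, min (h x) 1 ≤ ∫⁻ x, h x := lintegral_mono fun x => min_le_left _ _
  refine le_trans ?_ eh
  rw [ef, eg, lintegral_min_one_eq_meas_lt _ hf, lintegral_min_one_eq_meas_lt _ hg,
    lintegral_min_one_eq_meas_lt _ hh, ← lintegral_const_mul' _ _ ENNReal.ofReal_ne_top,
    ← lintegral_const_mul' _ _ ENNReal.ofReal_ne_top, ← lintegral_add_left]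
  · refine setLIntegral_mono' measurableSet_Ioo fun s hs => ?_
    have hs' : ENNReal.ofReal s < 1 := by simpa using hs.2
    obtain ⟨x₀, hx₀⟩ := lt_iSup_iff.1 (hf₁ ▸ hs')
    obtain ⟨y₀, hy₀⟩ := lt_iSup_iff.1 (hg₁ ▸ hs')
    have v : ∀ (c : ℝ) (hc : 0 < c) (k : ℝ → ℝ≥0∞),
        ENNReal.ofReal c * volume {x | ENNReal.ofReal s < k x} =
          volume (c • {x | ENNReal.ofReal s < k x}) := by
      intro c hc k
      rw [Measure.addHaar_smul]
      simp [abs_of_pos hc]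
    rw [v _ h1, v _ ht₀]
    refine Real.volume_add_volume_le_of_add_mem ?_ ?_ ?_ ?_ ?_
    · exact (measurableSet_lt measurable_const hf).const_smul₀ _
    · exact (measurableSet_lt measurable_const hg).const_smul₀ _
    · exact ⟨_, Set.smul_mem_smul_set hx₀⟩
    · exact ⟨_, Set.smul_mem_smul_set hy₀⟩
    · rintro _ ⟨x, hx, rfl⟩ _ ⟨y, hy, rfl⟩
      refine lt_of_lt_of_le ?_ (H x y)
      calc ENNReal.ofReal s = ENNReal.ofReal s ^ (1 - t) * ENNReal.ofReal s ^ t := by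
            rw [← ENNReal.rpow_add _ _ (by simpa using hs.1) ENNReal.ofReal_ne_top]; simp
        _ < _ := ENNReal.mul_lt_mul (ENNReal.rpow_lt_rpow hx h1) (ENNReal.rpow_lt_rpow hy ht₀)
  · refine Measurable.const_mul ?_ _
    refine Antitone.measurable fun a b hab => measure_mono fun x hx => ?_
    exact lt_of_le_of_lt (ENNReal.ofReal_le_ofReal hab) hx

theorem prekopa_leindler_real_of_bounded {t : ℝ} (ht₀ : 0 < t) (ht₁ : t < 1) {f g h : ℝ → ℝ≥0∞}
    (hf : Measurable f) (hg : Measurable g) (hh : Measurable h)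
    (hf₁ : ⨆ x, f x ≠ ∞) (hg₁ : ⨆ x, g x ≠ ∞)
    (H : ∀ x y, f x ^ (1 - t) * g y ^ t ≤ h ((1 - t) * x + t * y)) :
    (∫⁻ x, f x) ^ (1 - t) * (∫⁻ x, g x) ^ t ≤ ∫⁻ x, h x := by
  have h1 : 0 < 1 - t := by linarith
  set F := ⨆ x, f x with hF
  set G := ⨆ x, g x with hG
  rcases eq_or_ne F 0 with hF₀ | hF₀
  · have : ∀ x, f x = 0 := fun x => le_zero_iff.1 (hF₀ ▸ le_iSup f x)
    simp [this, h1]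
  rcases eq_or_ne G 0 with hG₀ | hG₀
  · have : ∀ x, g x = 0 := fun x => le_zero_iff.1 (hG₀ ▸ le_iSup g x)
    simp [this, ht₀]
  set c := F ^ (1 - t) * G ^ t with hc
  have hc₀ : c ≠ 0 := mul_ne_zero (by simp [hF₀, hf₁]) (by simp [hG₀, hg₁])
  have hc₁ : c ≠ ∞ := ENNReal.mul_ne_top (by simp [hF₀, hf₁]) (by simp [hG₀, hg₁])
  have e : ∀ a b : ℝ≥0∞, (F⁻¹ * a) ^ (1 - t) * (G⁻¹ * b) ^ t = c⁻¹ * (a ^ (1 - t) * b ^ t) := by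
    intro a b
    rw [ENNReal.mul_rpow_of_nonneg _ _ h1.le, ENNReal.mul_rpow_of_nonneg _ _ ht₀.le, hc,
      ENNReal.mul_inv (by simp [hF₀, hf₁]) (by simp [hF₀, hf₁]), ENNReal.inv_rpow, ENNReal.inv_rpow]
    ring
  have := prekopa_leindler_real_of_le_one ht₀ ht₁ (f := fun x => F⁻¹ * f x)
    (g := fun x => G⁻¹ * g x) (h := fun x => c⁻¹ * h x) (by fun_prop) (by fun_prop) (by fun_prop)
    (by rw [← ENNReal.mul_iSup]; exact ENNReal.inv_mul_cancel hF₀ hf₁)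
    (by rw [← ENNReal.mul_iSup]; exact ENNReal.inv_mul_cancel hG₀ hg₁)
    (fun x y => by rw [e]; gcongr; exact H x y)
  rw [lintegral_const_mul _ hf, lintegral_const_mul _ hg, lintegral_const_mul _ hh, e] at this
  exact (ENNReal.mul_le_mul_iff_right (ENNReal.inv_ne_zero.2 hc₁) (ENNReal.inv_ne_top.2 hc₀)).1 this

/-- The Prékopa-Leindler inequality on the line. -/
theorem prekopa_leindler_real {t : ℝ} (ht₀ : 0 < t) (ht₁ : t < 1) {f g h : ℝ → ℝ≥0∞}
    (hf : Measurable f) (hg : Measurable g) (hh : Measurable h)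
    (H : ∀ x y, f x ^ (1 - t) * g y ^ t ≤ h ((1 - t) * x + t * y)) :
    (∫⁻ x, f x) ^ (1 - t) * (∫⁻ x, g x) ^ t ≤ ∫⁻ x, h x := by
  have h1 : 0 < 1 - t := by linarith
  have trunc : ∀ k : ℝ → ℝ≥0∞, Measurable k → ∫⁻ x, k x = ⨆ N : ℕ, ∫⁻ x, min (k x) N := by
    intro k hk
    rw [← lintegral_iSup (f := fun (N : ℕ) x => min (k x) (N : ℝ≥0∞)) (fun N => hk.min measurable_const)
      (fun i j hij x => min_le_min le_rfl (by exact_mod_cast hij))]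
    refine lintegral_congr fun x => ?_
    rw [← inf_iSup_eq, ENNReal.iSup_natCast]
    simp
  have bdd : ∀ (k : ℝ → ℝ≥0∞) (N : ℕ), ⨆ x, min (k x) N ≠ ∞ := fun k N =>
    ne_top_of_le_ne_top (ENNReal.natCast_ne_top N) (iSup_le fun x => min_le_right _ _)
  have pow_iSup : ∀ (p : ℝ) (hp : 0 < p) (k : ℕ → ℝ≥0∞), (⨆ N, k N) ^ p = ⨆ N, k N ^ p :=
    fun p hp k => (ENNReal.orderIsoRpow p hp).map_iSup k
  rw [trunc f hf, trunc g hg, pow_iSup _ h1, pow_iSup _ ht₀, ENNReal.iSup_mul]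
  simp only [ENNReal.mul_iSup, iSup_le_iff]
  intro i j
  refine prekopa_leindler_real_of_bounded ht₀ ht₁ (hf.min measurable_const)
    (hg.min measurable_const) hh (bdd _ _)
    (bdd _ _) fun x y => le_trans ?_ (H x y)
  gcongr <;> exact min_le_left _ _

/-- The Prékopa-Leindler inequality. -/
theorem prekopa_leindler {t : ℝ} (ht₀ : 0 < t) (ht₁ : t < 1) :
    ∀ (n : ℕ) {f g h : (Fin n → ℝ) → ℝ≥0∞}, Measurable f → Measurable g → Measurable h →
    (∀ x y, f x ^ (1 - t) * g y ^ t ≤ h ((1 - t) • x + t • y)) →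
    (∫⁻ x, f x) ^ (1 - t) * (∫⁻ x, g x) ^ t ≤ ∫⁻ x, h x
  | 0, f, g, h, _, _, _, H => by
    simp only [lintegral_unique, volume_pi, Measure.pi_empty_univ, mul_one]
    convert H default default
  | n + 1, f, g, h, hf, hg, hh, H => by
    let c := (MeasurableEquiv.piFinSuccAbove (fun _ : Fin (n + 1) => ℝ) 0).symm
    have hc : ∀ a x, c (a, x) = Fin.cons a x := fun a x => Fin.insertNth_zero' _ _
    have e : ∀ k : (Fin (n + 1) → ℝ) → ℝ≥0∞, Measurable k →
        ∫⁻ x, k x = ∫⁻ a : ℝ, ∫⁻ x : Fin n → ℝ, k (c (a, x)) := by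
      intro k hk
      have mp := (volume_preserving_piFinSuccAbove (fun _ : Fin (n + 1) => ℝ) 0).symm
      rw [← mp.lintegral_comp hk, Measure.volume_eq_prod, lintegral_prod]
      exact (hk.comp mp.measurable).aemeasurable
    have m : ∀ k : (Fin (n + 1) → ℝ) → ℝ≥0∞, Measurable k → Measurable (fun p => k (c p)) :=
      fun k hk => hk.comp c.measurable
    rw [e f hf, e g hg, e h hh]
    refine prekopa_leindler_real ht₀ ht₁ (m f hf).lintegral_prod_right'
      (m g hg).lintegral_prod_right' (m h hh).lintegral_prod_right' fun a b => ?_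
    refine prekopa_leindler ht₀ ht₁ n ((m f hf).comp measurable_prodMk_left)
      ((m g hg).comp measurable_prodMk_left) ((m h hh).comp measurable_prodMk_left)
      fun x y => ?_
    convert H (c (a, x)) (c (b, y)) using 2
    simp only [hc]
    ext i
    refine Fin.cases ?_ (fun i => ?_) i <;> simp

/-- The multiplicative form of the Brunn-Minkowski inequality. -/
theorem volume_rpow_mul_volume_rpow_le {n : ℕ} {t : ℝ} (ht₀ : 0 < t) (ht₁ : t < 1)
    {A B C : Set (E n)} (hA : MeasurableSet A) (hB : MeasurableSet B) (hC : MeasurableSet C)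
    (h : ∀ a ∈ A, ∀ b ∈ B, (1 - t) • a + t • b ∈ C) :
    volume A ^ (1 - t) * volume B ^ t ≤ volume C := by
  have h1 : 0 < 1 - t := by linarith
  have hm := PiLp.volume_preserving_toLp (Fin n)
  have e : ∀ S : Set (E n), MeasurableSet S →
      volume S = ∫⁻ x : Fin n → ℝ, S.indicator 1 (WithLp.toLp 2 x) := by
    intro S hS
    rw [hm.lintegral_comp (measurable_one.indicator hS), lintegral_indicator_one hS]
  have m : ∀ S : Set (E n), MeasurableSet S →
      Measurable fun x : Fin n → ℝ => S.indicator (1 : E n → ℝ≥0∞) (WithLp.toLp 2 x) :=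
    fun S hS => (measurable_one.indicator hS).comp hm.measurable
  rw [e A hA, e B hB, e C hC]
  refine prekopa_leindler ht₀ ht₁ n (m A hA) (m B hB) (m C hC) fun x y => ?_
  by_cases hx : WithLp.toLp 2 x ∈ A
  · by_cases hy : WithLp.toLp 2 y ∈ B
    · have : WithLp.toLp 2 ((1 - t) • x + t • y) ∈ C := by simpa using h _ hx _ hy
      rw [Set.indicator_of_mem hx, Set.indicator_of_mem hy, Set.indicator_of_mem this]
      simp
    · simp [hy, ht₀]
  · simp [hx, h1]

theorem volume_real_smul {n : ℕ} {c : ℝ} (hc : 0 ≤ c) (A : Set (E n)) :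
    volume.real (c • A) = c ^ n * volume.real A := by
  rw [measureReal_def, measureReal_def, Measure.addHaar_smul]
  simp [abs_of_nonneg hc, pow_nonneg hc]

theorem measurableSet_smul_set {n : ℕ} {c : ℝ} {A : Set (E n)} (hA : MeasurableSet A)
    (hc : c ≠ 0) : MeasurableSet (c • A) := hA.const_smul_of_ne_zero hc

theorem brunn_minkowski_of_pos {n : ℕ} (hn : n ≠ 0) {t : ℝ} (ht₀ : 0 < t) (ht₁ : t < 1)
    {A B C : Set (E n)} (hA : MeasurableSet A) (hB : MeasurableSet B) (hC : MeasurableSet C)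
    (hC' : volume C ≠ ∞) (hA₀ : 0 < volume.real A) (hB₀ : 0 < volume.real B)
    (h : ∀ a ∈ A, ∀ b ∈ B, (1 - t) • a + t • b ∈ C) :
    (1 - t) * volume.real A ^ ((1 : ℝ) / n) + t * volume.real B ^ ((1 : ℝ) / n)
      ≤ volume.real C ^ ((1 : ℝ) / n) := by
  have h1 : 0 < 1 - t := by linarith
  set a := volume.real A ^ ((1 : ℝ) / n) with ha
  set b := volume.real B ^ ((1 : ℝ) / n) with hb
  have ha₀ : 0 < a := Real.rpow_pos_of_pos hA₀ _
  have hb₀ : 0 < b := Real.rpow_pos_of_pos hB₀ _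
  have han : a ^ n = volume.real A := by
    rw [ha, one_div, Real.rpow_inv_natCast_pow hA₀.le hn]
  have hbn : b ^ n = volume.real B := by
    rw [hb, one_div, Real.rpow_inv_natCast_pow hB₀.le hn]
  set s := (1 - t) * a + t * b with hs
  have hs₀ : 0 < s := by positivity
  have unit : ∀ (S : Set (E n)) (c : ℝ), 0 < c → c ^ n = volume.real S → volume (c⁻¹ • S) = 1 := by
    intro S c hc hcS
    have : volume.real (c⁻¹ • S) = 1 := by
      rw [volume_real_smul (inv_nonneg.2 hc.le), ← hcS, ← mul_pow, inv_mul_cancel₀ hc.ne', one_pow]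
    rwa [measureReal_def, ENNReal.toReal_eq_one_iff] at this
  have key := volume_rpow_mul_volume_rpow_le (n := n) (t := t * b / s) (by positivity)
    (by rw [div_lt_one hs₀]; have := mul_pos h1 ha₀; linarith)
    (measurableSet_smul_set hA (inv_ne_zero ha₀.ne')) (measurableSet_smul_set hB (inv_ne_zero hb₀.ne'))
    (measurableSet_smul_set hC (inv_ne_zero hs₀.ne')) (by
      rintro _ ⟨x, hx, rfl⟩ _ ⟨y, hy, rfl⟩
      refine ⟨_, h x hx y hy, ?_⟩
      simp only [smul_add, smul_smul]
      congr 2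
      · field_simp
        rw [hs]; ring
      · field_simp)
  rw [unit A a ha₀ han, unit B b hb₀ hbn, ENNReal.one_rpow, ENNReal.one_rpow, one_mul] at key
  have hfin : volume (s⁻¹ • C) ≠ ∞ := by
    rw [Measure.addHaar_smul]
    exact ENNReal.mul_ne_top ENNReal.ofReal_ne_top hC'
  have key2 : 1 ≤ volume.real (s⁻¹ • C) := by
    rw [measureReal_def]
    simpa using ENNReal.toReal_mono hfin key
  rw [volume_real_smul (inv_nonneg.2 hs₀.le), inv_pow, ← div_eq_inv_mul,
    one_le_div (by positivity)] at key2
  calc s = (s ^ n) ^ ((1 : ℝ) / n) := by rw [one_div, Real.pow_rpow_inv_natCast hs₀.le hn]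
    _ ≤ _ := Real.rpow_le_rpow (by positivity) key2 (by positivity)

theorem rpow_volume_le_of_smul_add_mem {n : ℕ} (hn : n ≠ 0) {c : ℝ} (hc : 0 ≤ c)
    {A C : Set (E n)} (hC' : volume C ≠ ∞) (b : E n) (h : ∀ a ∈ A, c • a + b ∈ C) :
    c * volume.real A ^ ((1 : ℝ) / n) ≤ volume.real C ^ ((1 : ℝ) / n) := by
  have : (fun x => x + b) '' (c • A) ⊆ C := by
    rintro _ ⟨_, ⟨x, hx, rfl⟩, rfl⟩
    exact h x hx
  have h2 := measureReal_mono this hC'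
  have h3 : volume.real ((fun x => x + b) '' (c • A)) = volume.real (c • A) := by
    simp [measureReal_def]
  rw [h3, volume_real_smul hc] at h2
  calc c * volume.real A ^ ((1 : ℝ) / n) = (c ^ n * volume.real A) ^ ((1 : ℝ) / n) := by
        rw [Real.mul_rpow (by positivity) (by positivity), one_div, Real.pow_rpow_inv_natCast hc hn]
    _ ≤ _ := Real.rpow_le_rpow (by positivity) h2 (by positivity)

/-- The Brunn-Minkowski inequality. -/
theorem brunn_minkowski {n : ℕ} (hn : n ≠ 0) {t : ℝ} (ht₀ : 0 < t) (ht₁ : t < 1)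
    {A B C : Set (E n)} (hA : MeasurableSet A) (hB : MeasurableSet B) (hC : MeasurableSet C)
    (hC' : volume C ≠ ∞) (hA₀ : A.Nonempty) (hB₀ : B.Nonempty)
    (h : ∀ a ∈ A, ∀ b ∈ B, (1 - t) • a + t • b ∈ C) :
    (1 - t) * volume.real A ^ ((1 : ℝ) / n) + t * volume.real B ^ ((1 : ℝ) / n)
      ≤ volume.real C ^ ((1 : ℝ) / n) := by
  have h1 : 0 < 1 - t := by linarith
  have hn' : (1 : ℝ) / n ≠ 0 := by positivity
  rcases eq_or_lt_of_le (measureReal_nonneg (μ := volume) (s := A)) with hA' | hA'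
  · obtain ⟨a, ha⟩ := hA₀
    rw [← hA', Real.zero_rpow hn', mul_zero, zero_add]
    exact rpow_volume_le_of_smul_add_mem hn ht₀.le hC' ((1 - t) • a)
      fun b hb => by rw [add_comm]; exact h a ha b hb
  rcases eq_or_lt_of_le (measureReal_nonneg (μ := volume) (s := B)) with hB' | hB'
  · obtain ⟨b, hb⟩ := hB₀
    rw [← hB', Real.zero_rpow hn', mul_zero, add_zero]
    exact rpow_volume_le_of_smul_add_mem hn h1.le hC' (t • b) fun a ha => h a ha b hb
  exact brunn_minkowski_of_pos hn ht₀ ht₁ hA hB hC hC' hA' hB' h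

/-- A measure concentrated on the unit sphere and invariant under linear isometries. -/
structure IsSphericallyInvariant {n : ℕ} (μ : Measure (E n)) : Prop where
  compl_sphere : μ (sphere (0 : E n) 1)ᶜ = 0
  map_eq : ∀ e : E n ≃ₗᵢ[ℝ] E n, μ.map e = μ

namespace IsSphericallyInvariant

variable {n : ℕ} {μ ν : Measure (E n)}

theorem ae_mem (h : IsSphericallyInvariant μ) : ∀ᵐ x ∂μ, x ∈ sphere (0 : E n) 1 :=
  mem_ae_iff.2 h.compl_sphere

theorem restrict_sphere (h : IsSphericallyInvariant μ) : μ.restrict (sphere (0 : E n) 1) = μ :=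
  Measure.restrict_eq_self_of_ae_mem h.ae_mem

theorem integrable [IsFiniteMeasure μ] (h : IsSphericallyInvariant μ) {f : E n → ℝ}
    (hf : ContinuousOn f (sphere 0 1)) : Integrable f μ := by
  rw [← h.restrict_sphere]
  exact hf.integrableOn_compact (isCompact_sphere 0 1)

theorem measure_ball_eq (h : IsSphericallyInvariant μ) {x y : E n} (hx : x ∈ sphere (0 : E n) 1)
    (hy : y ∈ sphere (0 : E n) 1) (r : ℝ) : μ (ball x r) = μ (ball y r) := by
  have hxy : ‖y‖ = ‖x‖ := by simp_all
  set e := (ℝ ∙ (y - x))ᗮ.reflection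
  have he : e y = x := Submodule.reflection_sub hxy
  calc μ (ball x r) = μ.map e (ball x r) := by rw [h.map_eq]
    _ = μ (e ⁻¹' (ball x r)) := Measure.map_apply e.continuous.measurable measurableSet_ball
    _ = μ (ball y r) := by
      rw [← he, LinearIsometryEquiv.preimage_ball, LinearIsometryEquiv.symm_apply_apply]

theorem measureReal_ball_pos [IsFiniteMeasure μ] (h : IsSphericallyInvariant μ) (h₀ : μ ≠ 0)
    {x : E n} (hx : x ∈ sphere (0 : E n) 1) {r : ℝ} (hr : 0 < r) : 0 < μ.real (ball x r) := by
  refine ENNReal.toReal_pos (fun h0 => h₀ ?_) (measure_ne_top _ _)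
  have : μ (sphere (0 : E n) 1) = 0 := measure_null_of_locally_null _ fun y hy =>
    ⟨ball y r, mem_nhdsWithin_of_mem_nhds (ball_mem_nhds y hr), by
      rw [h.measure_ball_eq hy hx, h0]⟩
  rw [← h.restrict_sphere, Measure.restrict_eq_zero, this]

theorem setIntegral_prod_comp_snd [IsFiniteMeasure μ] [IsFiniteMeasure ν]
    (hν : IsSphericallyInvariant ν) {f : E n → ℝ}
    (hf : Integrable f ν) {r g : ℝ} (hg : ∀ y ∈ sphere (0 : E n) 1, μ.real (ball y r) = g) :
    ∫ p in {p : E n × E n | dist p.1 p.2 < r}, f p.2 ∂(μ.prod ν) = g * ∫ y, f y ∂ν := by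
  have hB : MeasurableSet {p : E n × E n | dist p.1 p.2 < r} :=
    measurableSet_lt (by fun_prop) measurable_const
  rw [← integral_indicator hB, integral_prod_symm _ ((hf.comp_snd μ).indicator hB),
    ← integral_const_mul]
  refine integral_congr_ae ?_
  filter_upwards [hν.ae_mem] with y hy
  have : (fun x => {p : E n × E n | dist p.1 p.2 < r}.indicator (fun p => f p.2) (x, y)) =
      (ball y r).indicator fun _ => f y := by
    ext x
    by_cases hx : dist x y < r <;> simp [hx]
  rw [this, integral_indicator measurableSet_ball, setIntegral_const, hg y hy, smul_eq_mul]

theorem setIntegral_prod_comp_fst [IsFiniteMeasure μ] [IsFiniteMeasure ν]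
    (hμ : IsSphericallyInvariant μ) {f : E n → ℝ}
    (hf : Integrable f μ) {r g : ℝ} (hg : ∀ y ∈ sphere (0 : E n) 1, ν.real (ball y r) = g) :
    ∫ p in {p : E n × E n | dist p.1 p.2 < r}, f p.1 ∂(μ.prod ν) = g * ∫ y, f y ∂μ := by
  have hB : MeasurableSet {p : E n × E n | dist p.1 p.2 < r} :=
    measurableSet_lt (by fun_prop) measurable_const
  rw [← integral_indicator hB, integral_prod _ ((hf.comp_fst ν).indicator hB),
    ← integral_const_mul]
  refine integral_congr_ae ?_
  filter_upwards [hμ.ae_mem] with y hy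
  have : (fun x => {p : E n × E n | dist p.1 p.2 < r}.indicator (fun p => f p.1) (y, x)) =
      (ball y r).indicator fun _ => f y := by
    ext x
    by_cases hx : dist x y < r <;> simp [hx, dist_comm y x]
  rw [this, integral_indicator measurableSet_ball, setIntegral_const, hg y hy, smul_eq_mul]

/-- Uniqueness of the invariant measure on the sphere. -/
theorem integral_eq_mul_integral [IsFiniteMeasure μ] [IsFiniteMeasure ν]
    (hμ : IsSphericallyInvariant μ) (hν : IsSphericallyInvariant ν) (hν₀ : ν ≠ 0)
    {f : E n → ℝ} (hf : ContinuousOn f (sphere 0 1)) :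
    ∫ x, f x ∂μ = μ.real Set.univ / ν.real Set.univ * ∫ x, f x ∂ν := by
  obtain ⟨x₀, hx₀⟩ : (sphere (0 : E n) 1).Nonempty := by
    by_contra! hS
    refine hν₀ ?_
    rw [← hν.restrict_sphere, hS, Measure.restrict_empty]
  have hνu : 0 < ν.real Set.univ :=
    ENNReal.toReal_pos (by simpa using hν₀) (measure_ne_top _ _)
  refine eq_of_forall_dist_le fun ε hε => ?_
  obtain ⟨δ, hδ, hδε⟩ : ∃ δ > 0, δ * μ.real Set.univ ≤ ε := by
    refine ⟨ε / (μ.real Set.univ + 1), by positivity, ?_⟩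
    rw [div_mul_eq_mul_div, div_le_iff₀ (by positivity)]
    gcongr
    linarith
  obtain ⟨r, hr, hfr⟩ := Metric.uniformContinuousOn_iff.1
    ((isCompact_sphere (0 : E n) 1).uniformContinuousOn_of_continuous hf) δ hδ
  have hgμ : ∀ y ∈ sphere (0 : E n) 1, μ.real (ball y r) = μ.real (ball x₀ r) := fun y hy => by
    rw [measureReal_def, measureReal_def, hμ.measure_ball_eq hy hx₀]
  have hgν : ∀ y ∈ sphere (0 : E n) 1, ν.real (ball y r) = ν.real (ball x₀ r) := fun y hy => by
    rw [measureReal_def, measureReal_def, hν.measure_ball_eq hy hx₀]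
  have hg₀ : 0 < ν.real (ball x₀ r) := hν.measureReal_ball_pos hν₀ hx₀ hr
  set B := {p : E n × E n | dist p.1 p.2 < r}
  have hB : MeasurableSet B := measurableSet_lt (by fun_prop) measurable_const
  have i1 := hν.setIntegral_prod_comp_snd (hν.integrable hf) hgμ
  have i2 := hμ.setIntegral_prod_comp_fst (hμ.integrable hf) hgν
  have i3 := hν.setIntegral_prod_comp_snd (integrable_const (1 : ℝ)) hgμ
  have i4 := hμ.setIntegral_prod_comp_fst (integrable_const (1 : ℝ)) hgν
  simp only [integral_const, measureReal_restrict_apply_univ, smul_eq_mul, mul_one] at i3 i4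
  have hbound : ‖∫ p in B, (f p.1 - f p.2) ∂(μ.prod ν)‖ ≤ δ * (μ.prod ν).real B := by
    refine norm_setIntegral_le_of_norm_le_const_ae (measure_lt_top _ _) ?_
    rw [ae_restrict_iff' hB]
    have a1 : ∀ᵐ p ∂(μ.prod ν), p.1 ∈ sphere (0 : E n) 1 :=
      Measure.quasiMeasurePreserving_fst.ae hμ.ae_mem
    have a2 : ∀ᵐ p ∂(μ.prod ν), p.2 ∈ sphere (0 : E n) 1 :=
      Measure.quasiMeasurePreserving_snd.ae hν.ae_mem
    filter_upwards [a1, a2] with p h1 h2 hp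
    exact (hfr _ h1 _ h2 hp).le
  rw [integral_sub ((hμ.integrable hf).comp_fst ν).integrableOn
    ((hν.integrable hf).comp_snd μ).integrableOn, i1, i2, i4] at hbound
  rw [i4] at i3
  set g := ν.real (ball x₀ r)
  set k := μ.real (ball x₀ r)
  have hk : k = g * μ.real Set.univ / ν.real Set.univ := by
    rw [i3]
    field_simp
  rw [hk] at hbound
  have e : g * ∫ x, f x ∂μ - g * μ.real Set.univ / ν.real Set.univ * ∫ x, f x ∂ν =
    g * (∫ x, f x ∂μ - μ.real Set.univ / ν.real Set.univ * ∫ x, f x ∂ν) := by ring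
  rw [Real.dist_eq]
  refine le_trans ?_ hδε
  rw [Real.norm_eq_abs] at hbound
  have : g * |∫ x, f x ∂μ - μ.real Set.univ / ν.real Set.univ * ∫ x, f x ∂ν| ≤
      g * (δ * μ.real Set.univ) := by
    rw [← abs_of_pos hg₀, ← abs_mul, abs_of_pos hg₀, ← e]
    linarith
  exact le_of_mul_le_mul_left this hg₀

end IsSphericallyInvariant

theorem finiteAtFilter_hausdorffMeasure_sphere {m : ℕ} {x : E (m + 1)}
    (hx : x ∈ sphere (0 : E (m + 1)) 1) :
    (μH[(m : ℝ)] : Measure (E (m + 1))).FiniteAtFilter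
      (nhdsWithin x (sphere (0 : E (m + 1)) 1)) := by
  have hx1 : ‖x‖ = 1 := by simpa using hx
  have hx0 : x ≠ 0 := by rintro rfl; simp at hx1
  have hfact : Fact (Module.finrank ℝ (E (m + 1)) = m + 1) := ⟨by simp⟩
  let F := (ℝ ∙ x)ᗮ
  have hF : Module.finrank ℝ F = m := Submodule.finrank_orthogonal_span_singleton hx0
  let ψ : F → E (m + 1) := fun w => ‖x + (w : E (m + 1))‖⁻¹ • (x + (w : E (m + 1)))
  have hadd : ContDiff ℝ 1 (fun w : F => x + (w : E (m + 1))) :=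
    contDiff_const.add F.subtypeL.contDiff
  have hψ : ContDiffAt ℝ 1 ψ 0 :=
    ((hadd.contDiffAt.norm ℝ (by simpa using hx0)).inv (by simpa using hx0)).smul
      hadd.contDiffAt
  obtain ⟨K, t, ht, hK⟩ := hψ.exists_lipschitzOnWith
  obtain ⟨r, hr, hrt⟩ := Metric.mem_nhds_iff.1 ht
  have hfin : μH[(m : ℝ)] (ψ '' ball 0 r) < ∞ := by
    refine lt_of_le_of_lt ((hK.mono hrt).hausdorffMeasure_image_le (Nat.cast_nonneg m)) ?_
    refine ENNReal.mul_lt_top (by simp) ?_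
    have h := isAddHaarMeasure_hausdorffMeasure (E := F)
    rw [hF] at h
    exact measure_ball_lt_top
  refine ⟨ψ '' ball 0 r, ?_, hfin⟩
  let π : E (m + 1) → E (m + 1) := fun y => ⟪x, y⟫⁻¹ • y - x
  have hxx : ⟪x, x⟫ = 1 := by rw [real_inner_self_eq_norm_sq, hx1, one_pow]
  have hπc : ContinuousAt π x := by
    have hc : ContinuousAt (fun y => ⟪x, y⟫) x := by fun_prop
    exact ((hc.inv₀ (by simp [hx1])).smul continuousAt_id).sub continuousAt_const
  have hπx : π x = 0 := by simp [π, hx1]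
  have hpos : ∀ᶠ y in nhds x, 0 < ⟪x, y⟫ := by
    refine ContinuousAt.eventually_lt (continuousAt_const) (by fun_prop) ?_
    rw [hxx]; exact one_pos
  have hnear : ∀ᶠ y in nhds x, ‖π y‖ < r := by
    refine ContinuousAt.eventually_lt hπc.norm continuousAt_const ?_
    simpa [hπx] using hr
  filter_upwards [nhdsWithin_le_nhds hpos, nhdsWithin_le_nhds hnear, self_mem_nhdsWithin]
    with y hy hyr hyS
  have hy1 : ‖y‖ = 1 := by simpa using hyS
  refine ⟨⟨π y, ?_⟩, ?_, ?_⟩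
  · rw [Submodule.mem_orthogonal_singleton_iff_inner_right]
    simp only [π, inner_sub_right, inner_smul_right, hxx]
    rw [inv_mul_cancel₀ hy.ne', sub_self]
  · simpa using hyr
  · simp only [ψ, π, add_sub_cancel, norm_smul, hy1, norm_inv, Real.norm_eq_abs, abs_of_pos hy,
      mul_one, inv_inv, smul_smul, mul_inv_cancel₀ hy.ne', one_smul]

theorem hausdorffMeasure_sphere_lt_top (m : ℕ) :
    μH[(m : ℝ)] (sphere (0 : E (m + 1)) 1) < ∞ :=
  (isCompact_sphere 0 1).measure_lt_top_of_nhdsWithin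
    fun _ hx => finiteAtFilter_hausdorffMeasure_sphere hx

theorem LinearIsometryEquiv.preimage_sphere_one {n : ℕ} (e : E n ≃ₗᵢ[ℝ] E n) :
    e ⁻¹' sphere (0 : E n) 1 = sphere 0 1 := by
  ext x; simp

theorem isSphericallyInvariant_hausdorffMeasure {n : ℕ} (d : ℝ) :
    IsSphericallyInvariant ((μH[d] : Measure (E n)).restrict (sphere (0 : E n) 1)) where
  compl_sphere := by
    rw [Measure.restrict_apply isClosed_sphere.measurableSet.compl]; simp
  map_eq e := by
    nth_rewrite 1 [← e.preimage_sphere_one]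
    rw [← Measure.restrict_map e.continuous.measurable isClosed_sphere.measurableSet]
    congr 1
    exact e.toIsometryEquiv.map_hausdorffMeasure d

/-- The cone measure on the sphere: the image of Lebesgue measure on the punctured unit ball under
the radial projection. -/
def coneMeasure (n : ℕ) : Measure (E n) :=
  (volume.restrict (closedBall (0 : E n) 1 \ {0})).map fun x => ‖x‖⁻¹ • x

theorem measurable_normalize (n : ℕ) : Measurable fun x : E n => ‖x‖⁻¹ • x := by fun_prop

instance (n : ℕ) : IsFiniteMeasure (volume.restrict (closedBall (0 : E n) 1 \ {0})) :=
  ⟨by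
    rw [Measure.restrict_apply_univ]
    exact (measure_mono Set.sdiff_subset).trans_lt measure_closedBall_lt_top⟩

instance (n : ℕ) : IsFiniteMeasure (coneMeasure n) := by
  unfold coneMeasure; infer_instance

theorem coneMeasure_ne_zero {n : ℕ} (hn : n ≠ 0) : coneMeasure n ≠ 0 := by
  have : NeZero n := ⟨hn⟩
  have : Nonempty (Fin n) := ⟨0⟩
  rw [coneMeasure, Ne, Measure.map_eq_zero_iff (measurable_normalize n).aemeasurable,
    Measure.restrict_eq_zero, measure_sdiff_null (by simp)]
  exact (measure_closedBall_pos _ _ one_pos).ne'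

theorem isSphericallyInvariant_coneMeasure (n : ℕ) : IsSphericallyInvariant (coneMeasure n) where
  compl_sphere := by
    have hm : MeasurableSet (closedBall (0 : E n) 1 \ {0}) :=
      measurableSet_closedBall.diff (measurableSet_singleton 0)
    rw [coneMeasure, Measure.map_apply (measurable_normalize n) isClosed_sphere.measurableSet.compl,
      Measure.restrict_apply' hm]
    convert measure_empty (μ := volume)
    ext x
    simp only [Set.mem_inter_iff, Set.mem_preimage, Set.mem_compl_iff, mem_sphere_iff_norm, sub_zero,
      norm_smul, norm_inv, norm_norm, Set.mem_sdiff, Set.mem_singleton_iff, Set.mem_empty_iff_false,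
      iff_false, not_and, not_not]
    intro h _
    by_contra hx
    exact h (inv_mul_cancel₀ (norm_ne_zero_iff.2 hx))
  map_eq e := by
    have hm : MeasurableSet (closedBall (0 : E n) 1 \ {0}) :=
      measurableSet_closedBall.diff (measurableSet_singleton 0)
    have hpre : e ⁻¹' (closedBall (0 : E n) 1 \ {0}) = closedBall 0 1 \ {0} := by
      ext x; simp
    rw [coneMeasure, Measure.map_map e.continuous.measurable (measurable_normalize n)]
    have hcomp : (e ∘ fun x : E n => ‖x‖⁻¹ • x) = (fun x => ‖x‖⁻¹ • x) ∘ e := by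
      ext1 x; simp
    rw [hcomp, ← Measure.map_map (measurable_normalize n) e.continuous.measurable]
    congr 1
    nth_rewrite 1 [← hpre]
    rw [← Measure.restrict_map e.continuous.measurable hm, e.measurePreserving.map_eq]

namespace memC

variable {n : ℕ} {h : E n → ℝ}

theorem contDiffAt (hh : memC n h) {x : E n} (hx : x ≠ 0) : ContDiffAt ℝ 2 h x :=
  hh.2.1.contDiffAt (isOpen_compl_singleton.mem_nhds hx)

theorem hasGradientAt (hh : memC n h) {x : E n} (hx : x ≠ 0) :
    HasGradientAt h (gradient h x) x :=
  ((hh.contDiffAt hx).differentiableAt (by norm_num)).hasGradientAt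

theorem contDiffAt_gradient (hh : memC n h) {x : E n} (hx : x ≠ 0) :
    ContDiffAt ℝ 1 (gradient h) x :=
  (InnerProductSpace.toDual ℝ (E n)).symm.contDiff.contDiffAt.comp x
    ((hh.contDiffAt hx).fderiv_right (by norm_num))

theorem hasFDerivAt_gradient (hh : memC n h) {x : E n} (hx : x ≠ 0) :
    HasFDerivAt (gradient h) (sHess h x) x :=
  ((hh.contDiffAt_gradient hx).differentiableAt (by norm_num)).hasFDerivAt

theorem continuousAt_sHess (hh : memC n h) {x : E n} (hx : x ≠ 0) : ContinuousAt (sHess h) x :=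
  ((hh.contDiffAt_gradient hx).fderiv_right (m := 0) (by norm_num)).continuousAt

theorem gradient_smul (hh : memC n h) {x : E n} (hx : x ≠ 0) {r : ℝ} (hr : 0 < r) :
    gradient h (r • x) = gradient h x := by
  have hrx : r • x ≠ 0 := smul_ne_zero hr.ne' hx
  have h1 : HasFDerivAt (fun y => r⁻¹ * h (r • y))
      (r⁻¹ • ((InnerProductSpace.toDual ℝ (E n) (gradient h (r • x))).comp
        (r • ContinuousLinearMap.id ℝ (E n)))) x :=
    ((hh.hasGradientAt hrx).hasFDerivAt.comp x
      ((hasFDerivAt_id x).const_smul r)).const_mul r⁻¹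
  have h2 : (fun y => r⁻¹ * h (r • y)) = h := by
    ext y
    rw [hh.1 r hr, inv_mul_cancel_left₀ hr.ne']
  rw [h2] at h1
  have h3 : r⁻¹ • ((InnerProductSpace.toDual ℝ (E n) (gradient h (r • x))).comp
        (r • ContinuousLinearMap.id ℝ (E n))) =
      InnerProductSpace.toDual ℝ (E n) (gradient h (r • x)) := by
    ext v; simp [inv_mul_cancel_left₀ hr.ne']
  rw [h3] at h1
  have h4 : HasGradientAt h (gradient h (r • x)) x := h1
  exact h4.gradient.symm

theorem inner_gradient_self (hh : memC n h) {x : E n} (hx : x ≠ 0) :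
    ⟪gradient h x, x⟫ = h x := by
  have hx' : (1 : ℝ) • x ≠ 0 := by simpa using hx
  have h1 : HasDerivAt (fun r : ℝ => h (r • x)) ⟪gradient h x, x⟫ 1 := by
    have := (hh.hasGradientAt hx').hasFDerivAt.comp_hasDerivAt (1 : ℝ)
      ((hasDerivAt_id (1 : ℝ)).smul_const x)
    simpa using! this
  have h2 : HasDerivAt (fun r : ℝ => h (r • x)) (h x) 1 := by
    have := (hasDerivAt_id (1 : ℝ)).mul_const (h x)
    rw [one_mul] at this
    refine this.congr_of_eventuallyEq ?_
    filter_upwards [lt_mem_nhds (zero_lt_one' ℝ)] with r hr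
    exact hh.1 r hr x
  exact h1.unique h2

theorem sHess_self (hh : memC n h) {x : E n} (hx : x ≠ 0) : sHess h x x = 0 := by
  have hx' : (1 : ℝ) • x ≠ 0 := by simpa using hx
  have h1 : HasDerivAt (fun r : ℝ => gradient h (r • x)) (sHess h x x) 1 := by
    have := (hh.hasFDerivAt_gradient hx').comp_hasDerivAt (1 : ℝ)
      ((hasDerivAt_id (1 : ℝ)).smul_const x)
    simpa using! this
  have h2 : HasDerivAt (fun r : ℝ => gradient h (r • x)) 0 1 := by
    refine (hasDerivAt_const (1 : ℝ) (gradient h x)).congr_of_eventuallyEq ?_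
    filter_upwards [lt_mem_nhds (zero_lt_one' ℝ)] with r hr
    exact hh.gradient_smul hx hr
  exact h1.unique h2

theorem inner_sHess_self (hh : memC n h) {x : E n} (hx : x ≠ 0) (v : E n) :
    ⟪sHess h x v, x⟫ = 0 := by
  have h1 := (hh.hasFDerivAt_gradient hx).inner ℝ (hasFDerivAt_id x)
  have h2 : HasFDerivAt (fun y => ⟪gradient h y, y⟫)
      (InnerProductSpace.toDual ℝ (E n) (gradient h x)) x := by
    refine (hh.hasGradientAt hx).hasFDerivAt.congr_of_eventuallyEq ?_
    filter_upwards [isOpen_compl_singleton.mem_nhds hx] with y hy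
    exact hh.inner_gradient_self hy
  have h3 := DFunLike.congr_fun (h1.unique h2) v
  simpa using h3

theorem sHess_smul (hh : memC n h) {x : E n} (hx : x ≠ 0) {r : ℝ} (hr : 0 < r) :
    r • sHess h (r • x) = sHess h x := by
  have hrx : r • x ≠ 0 := smul_ne_zero hr.ne' hx
  have h1 : HasFDerivAt (fun y => gradient h (r • y))
      ((sHess h (r • x)).comp (r • ContinuousLinearMap.id ℝ (E n))) x :=
    (hh.hasFDerivAt_gradient hrx).comp x ((hasFDerivAt_id x).const_smul r)
  have h2 : HasFDerivAt (fun y => gradient h (r • y)) (sHess h x) x := by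
    refine (hh.hasFDerivAt_gradient hx).congr_of_eventuallyEq ?_
    filter_upwards [isOpen_compl_singleton.mem_nhds hx] with y hy
    exact hh.gradient_smul hy hr
  rw [← h1.unique h2]
  ext v; simp

theorem inner_sHess_pos_of_sphere (hh : memC n h) {u : E n} (hu : u ∈ sphere (0 : E n) 1) {v : E n}
    (hv : v ∉ ℝ ∙ u) : 0 < ⟪sHess h u v, v⟫ := by
  have hu1 : ‖u‖ = 1 := by simpa using hu
  have hu0 : u ≠ 0 := by rintro rfl; simp at hu1
  have huu : ⟪u, u⟫ = 1 := by rw [real_inner_self_eq_norm_sq, hu1, one_pow]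
  set w := v - ⟪u, v⟫ • u with hw
  have hvw : v = w + ⟪u, v⟫ • u := by simp [hw]
  have hw0 : w ≠ 0 := fun h0 => hv (Submodule.mem_span_singleton.2 ⟨⟪u, v⟫, by
    rw [hvw, h0, zero_add]; simp [inner_smul_right, hu1]⟩)
  have hwu : w ∈ (ℝ ∙ u)ᗮ := by
    rw [Submodule.mem_orthogonal_singleton_iff_inner_right, hw, inner_sub_right, inner_smul_right,
      huu, mul_one, sub_self]
  have := hh.2.2 u hu w hwu hw0
  rw [hvw, map_add, map_smul, hh.sHess_self hu0, smul_zero, add_zero, inner_add_right,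
    inner_smul_right, hh.inner_sHess_self hu0, mul_zero, add_zero]
  exact this

theorem inner_sHess_pos (hh : memC n h) {x : E n} (hx : x ≠ 0) {v : E n}
    (hv : v ∉ ℝ ∙ x) : 0 < ⟪sHess h x v, v⟫ := by
  have hr : 0 < ‖x‖⁻¹ := inv_pos.2 (norm_pos_iff.2 hx)
  have hu : ‖x‖⁻¹ • x ∈ sphere (0 : E n) 1 := by
    simp [norm_smul, hx]
  have hspan : v ∉ ℝ ∙ (‖x‖⁻¹ • x) := by
    rwa [Submodule.span_singleton_smul_eq (IsUnit.mk0 _ hr.ne')]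
  have h1 := hh.inner_sHess_pos_of_sphere hu hspan
  rw [← hh.sHess_smul hx hr, smul_apply, inner_smul_left]
  exact mul_pos hr h1

theorem inner_gradient_lt_of_linearIndependent (hh : memC n h) {u w : E n}
    (hind : ∀ a b : ℝ, a • u + b • w = 0 → a = 0 ∧ b = 0) : ⟪gradient h u, w⟫ < h w := by
  have hu : u ≠ 0 := by
    rintro rfl
    exact one_ne_zero (hind 1 0 (by simp)).1
  let p : ℝ → E n := fun s => u + s • (w - u)
  have hp0 : ∀ s, p s ≠ 0 := by
    intro s hs
    have := hind (1 - s) s (by rw [← hs]; simp only [p]; module)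
    linarith [this.1, this.2]
  have hpw : ∀ s, w - u ∉ ℝ ∙ (p s) := by
    intro s hs
    obtain ⟨c, hc⟩ := Submodule.mem_span_singleton.1 hs
    have := hind (c - c * s + 1) (c * s - 1) (by
      have : c • p s - (w - u) = 0 := by rw [hc, sub_self]
      rw [← this]; simp only [p]; module)
    have h0 : c = 0 := by linarith [this.1, this.2]
    have := this.2
    rw [h0] at this
    norm_num at this
  have hpd : ∀ s, HasDerivAt p (w - u) s := fun s => by
    have := ((hasDerivAt_id s).smul_const (w - u)).const_add u
    rwa [one_smul] at this
  have hg : ∀ s, HasDerivAt (fun s => h (p s)) ⟪gradient h (p s), w - u⟫ s := fun s => by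
    simpa using! (hh.hasGradientAt (hp0 s)).hasFDerivAt.comp_hasDerivAt s (hpd s)
  have hg' : ∀ s, HasDerivAt (fun s => ⟪gradient h (p s), w - u⟫)
      ⟪sHess h (p s) (w - u), w - u⟫ s := fun s => by
    have := ((hh.hasFDerivAt_gradient (hp0 s)).comp_hasDerivAt s (hpd s)).inner ℝ
      (hasDerivAt_const s (w - u))
    simpa using! this
  have hmono : StrictMono fun s => ⟪gradient h (p s), w - u⟫ :=
    strictMono_of_deriv_pos fun s => by
      rw [(hg' s).deriv]
      exact hh.inner_sHess_pos (hp0 s) (hpw s)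
  obtain ⟨s, hs, hs'⟩ := exists_hasDerivAt_eq_slope (fun s => h (p s)) _ (zero_lt_one' ℝ)
    (fun s _ => (hg s).continuousAt.continuousWithinAt) (fun s _ => hg s)
  have h01 := hmono hs.1
  have hp0' : p 0 = u := by simp [p]
  have hp1' : p 1 = w := by simp [p]
  simp only [hp0', hp1', sub_zero, div_one] at h01 hs'
  rw [hs', inner_sub_right, hh.inner_gradient_self hu] at h01
  linarith

end memC

theorem linearIndependent_of_mem_sphere {n : ℕ} {u w : E n} (hu : u ∈ sphere (0 : E n) 1)
    (hw : w ∈ sphere (0 : E n) 1) (h : u ≠ w) (h' : u ≠ -w) (a b : ℝ) (hab : a • u + b • w = 0) :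
    a = 0 ∧ b = 0 := by
  have hu1 : ‖u‖ = 1 := by simpa using hu
  have hw1 : ‖w‖ = 1 := by simpa using hw
  have e : a • u = -(b • w) := eq_neg_of_add_eq_zero_left hab
  have hn : |a| = |b| := by
    simpa [norm_smul, hu1, hw1] using congrArg norm e
  have ha : a = 0 := by
    by_contra ha
    rcases abs_eq_abs.1 hn with rfl | rfl
    · rw [← smul_neg] at e
      exact h' (smul_right_injective _ ha e)
    · rw [neg_smul, ← smul_neg, ← smul_neg, smul_right_inj (by simpa using ha)] at e
      exact h (by simpa using e)
  exact ⟨ha, by simpa [ha] using hn.symm⟩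

theorem exists_mem_sphere_ne {n : ℕ} (hn : 2 ≤ n) (u : E n) :
    ∃ v ∈ sphere (0 : E n) 1, v ≠ u ∧ v ≠ -u := by
  let i : Fin n := ⟨0, by omega⟩
  let j : Fin n := ⟨1, by omega⟩
  let s : ℝ := (Real.sqrt 2)⁻¹
  by_contra! H
  have hij : i ≠ j := by simp [i, j]
  have hi := H (EuclideanSpace.single i 1) (by simp)
  have hj := H (EuclideanSpace.single j 1) (by simp)
  by_cases hui : EuclideanSpace.single i (1 : ℝ) = u
  · by_cases huj : EuclideanSpace.single j (1 : ℝ) = u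
    · have := congrArg (fun x : E n => x i) (hui.trans huj.symm)
      simp [hij] at this
    · have := congrArg (fun x : E n => x i) (hj huj)
      simp [hij, ← hui] at this
  · by_cases huj : EuclideanSpace.single j (1 : ℝ) = u
    · have := congrArg (fun x : E n => x i) (hi hui)
      simp [hij, ← huj] at this
    · have := congrArg (fun x : E n => x i) ((hi hui).trans (hj huj).symm)
      simp [hij] at this

theorem memC.inner_gradient_lt {n : ℕ} {h : E n → ℝ} (hn : 2 ≤ n) (hh : memC n h) {u w : E n}
    (hu : u ∈ sphere (0 : E n) 1) (hw : w ∈ sphere (0 : E n) 1) (huw : u ≠ w) :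
    ⟪gradient h u, w⟫ < h w := by
  by_cases h' : u = -w
  · obtain ⟨v, hv, hvw, hvw'⟩ := exists_mem_sphere_ne hn w
    have hw0 : w ≠ 0 := ne_zero_of_mem_unit_sphere ⟨w, hw⟩
    have hu0 : u ≠ 0 := ne_zero_of_mem_unit_sphere ⟨u, hu⟩
    have h1 := hh.inner_gradient_lt_of_linearIndependent
      (linearIndependent_of_mem_sphere hv hw hvw hvw')
    have h2 := hh.inner_gradient_lt_of_linearIndependent
      (linearIndependent_of_mem_sphere hv hu (h' ▸ hvw') (by rw [h', neg_neg]; exact hvw))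
    have h3 := hh.inner_gradient_self hu0
    have e : w = -u := by rw [h', neg_neg]
    rw [e, inner_neg_right] at h1 ⊢
    linarith
  · exact hh.inner_gradient_lt_of_linearIndependent (linearIndependent_of_mem_sphere hu hw huw h')

theorem hasFDerivAt_norm_of_ne_zero {V : Type*} [NormedAddCommGroup V] [InnerProductSpace ℝ V]
    {x : V} (hx : x ≠ 0) : HasFDerivAt (fun y : V => ‖y‖) (‖x‖⁻¹ • innerSL ℝ x) x := by
  have h1 : HasFDerivAt (fun y : V => ‖y‖ ^ 2) (2 • innerSL ℝ x) x := by
    simpa using (hasFDerivAt_id x).norm_sq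
  have h2 := h1.sqrt (by simpa using hx)
  simp only [Real.sqrt_sq (norm_nonneg _)] at h2
  refine h2.congr_fderiv ?_
  ext v
  simp
  ring

namespace memC

variable {n : ℕ} {h : E n → ℝ}

theorem hasFDerivAt_norm_smul_gradient (hh : memC n h) {x : E n} (hx : x ≠ 0) :
    HasFDerivAt (fun y => ‖y‖ • gradient h y)
      (sHess h (‖x‖⁻¹ • x) + (innerSL ℝ (‖x‖⁻¹ • x)).smulRight (gradient h (‖x‖⁻¹ • x))) x := by
  have hr : 0 < ‖x‖⁻¹ := inv_pos.2 (norm_pos_iff.2 hx)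
  refine ((hasFDerivAt_norm_of_ne_zero hx).smul (hh.hasFDerivAt_gradient hx)).congr_fderiv ?_
  rw [← hh.sHess_smul hx hr, hh.gradient_smul hx hr, smul_smul,
    mul_inv_cancel₀ (norm_ne_zero_iff.2 hx), one_smul, map_smul]

theorem sdet_eq (hh : memC n h) {u : E n} (hu : u ≠ 0) :
    sdet h u = (sHess h u + (innerSL ℝ u).smulRight u).det := by
  have : (tproj u).comp ((sHess h u).comp (tproj u)) = sHess h u := by
    ext1 v
    simp only [tproj, ContinuousLinearMap.comp_apply, sub_apply,
      ContinuousLinearMap.id_apply, ContinuousLinearMap.smulRight_apply, innerSL_apply_apply,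
      map_sub, map_smul, hh.sHess_self hu, smul_zero, sub_zero]
    simp [real_inner_comm _ u, hh.inner_sHess_self hu]
  rw [sdet, this]

theorem det_sHess_add_gradient (hh : memC n h) {u : E n} (hu : u ∈ sphere (0 : E n) 1) :
    (sHess h u + (innerSL ℝ u).smulRight (gradient h u)).det = h u * sdet h u := by
  have hu1 : ‖u‖ = 1 := by simpa using hu
  have hu0 : u ≠ 0 := ne_zero_of_mem_unit_sphere ⟨u, hu⟩
  have hL : ((sHess h u + (innerSL ℝ u).smulRight (gradient h u) : E n →L[ℝ] E n) :
      E n →ₗ[ℝ] E n) =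
      LinearMap.transvection (innerSL ℝ u : E n →ₗ[ℝ] ℝ) (gradient h u - u) ∘ₗ
        ((sHess h u + (innerSL ℝ u).smulRight u : E n →L[ℝ] E n) : E n →ₗ[ℝ] E n) := by
    ext1 v
    have := hh.inner_sHess_self hu0 v
    rw [real_inner_comm] at this
    simp [LinearMap.transvection.apply, this, inner_add_right, inner_smul_right, hu1]
    module
  rw [hh.sdet_eq hu0, ContinuousLinearMap.det, hL, LinearMap.det_comp, LinearMap.transvection.det]
  have := hh.inner_gradient_self hu0
  rw [real_inner_comm] at this
  simp [inner_sub_right, this, hu1, ContinuousLinearMap.det]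

end memC

theorem ContinuousLinearMap.det_pos_of_inner_pos {n : ℕ} {A : E n →L[ℝ] E n}
    (hA : ∀ v, v ≠ 0 → 0 < ⟪A v, v⟫) : 0 < A.det := by
  let p : ℝ → E n →L[ℝ] E n := fun s => (1 - s) • ContinuousLinearMap.id ℝ (E n) + s • A
  have hp : Continuous fun s => (p s).det :=
    ContinuousLinearMap.continuous_det.comp (by fun_prop)
  have h0 : ∀ s ∈ Set.Icc (0 : ℝ) 1, (p s).det ≠ 0 := by
    intro s hs h0
    obtain ⟨v, hv, hv0⟩ := Submodule.exists_mem_ne_zero_of_ne_bot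
      (LinearMap.det_eq_zero_iff_ker_ne_bot.1 h0)
    have hv' : (1 - s) • v + s • A v = 0 := by simpa [p] using! hv
    have h1 := congrArg (fun w => ⟪w, v⟫) hv'
    simp only [inner_add_left, inner_smul_left, inner_zero_left, real_inner_self_eq_norm_sq,
      conj_trivial] at h1
    have h2 := hA v hv0
    have h3 : 0 < ‖v‖ ^ 2 := by positivity
    rcases hs.1.eq_or_lt with rfl | hs0
    · linarith
    · nlinarith [mul_pos hs0 h2, mul_nonneg (sub_nonneg.2 hs.2) h3.le]
  by_contra! h1
  have hp0 : (p 0).det = 1 := by simp [p, ContinuousLinearMap.det]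
  have hp1 : (p 1).det = A.det := by congr 1; ext1 v; simp [p]
  obtain ⟨s, hs, hs'⟩ := intermediate_value_Icc' zero_le_one hp.continuousOn
    (show (0 : ℝ) ∈ Set.Icc (p 1).det (p 0).det by rw [hp0, hp1]; exact ⟨h1, zero_le_one⟩)
  exact h0 s hs hs'

namespace memC

variable {n : ℕ} {h : E n → ℝ}

theorem sdet_pos (hh : memC n h) {u : E n} (hu : u ∈ sphere (0 : E n) 1) : 0 < sdet h u := by
  have hu1 : ‖u‖ = 1 := by simpa using hu
  have hu0 : u ≠ 0 := ne_zero_of_mem_unit_sphere ⟨u, hu⟩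
  rw [hh.sdet_eq hu0]
  refine ContinuousLinearMap.det_pos_of_inner_pos fun v hv => ?_
  have e : ⟪(sHess h u + (innerSL ℝ u).smulRight u) v, v⟫ = ⟪sHess h u v, v⟫ + ⟪u, v⟫ ^ 2 := by
    simp [inner_add_left, inner_smul_left, sq]
  rw [e]
  by_cases hs : v ∈ ℝ ∙ u
  · obtain ⟨c, rfl⟩ := Submodule.mem_span_singleton.1 hs
    have hc : c ≠ 0 := by rintro rfl; simp at hv
    simp [hh.sHess_self hu0, inner_smul_right, hu1, sq_pos_of_ne_zero hc]
  · have := hh.inner_sHess_pos hu0 hs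
    positivity

theorem continuousOn_sdet (hh : memC n h) : ContinuousOn (sdet h) (sphere (0 : E n) 1) := by
  have h1 : ∀ u ∈ sphere (0 : E n) 1, u ≠ 0 := fun u hu => ne_zero_of_mem_unit_sphere ⟨u, hu⟩
  refine ContinuousOn.congr (f := fun u => (sHess h u + (innerSL ℝ u).smulRight u).det) ?_
    fun u hu => hh.sdet_eq (h1 u hu)
  refine ContinuousLinearMap.continuous_det.comp_continuousOn fun u hu => ?_
  have : Continuous fun u : E n => (innerSL ℝ u).smulRight u := by fun_prop
  exact ((hh.continuousAt_sHess (h1 u hu)).add this.continuousAt).continuousWithinAt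

theorem continuousOn (hh : memC n h) : ContinuousOn h (sphere (0 : E n) 1) :=
  hh.2.1.continuousOn.mono fun u hu => ne_zero_of_mem_unit_sphere ⟨u, hu⟩

end memC

/-- The convex body whose support function is `h`, when `h` is convex and `1`-homogeneous. -/
def wulffShape {n : ℕ} (h : E n → ℝ) : Set (E n) := {y | ∀ u ∈ sphere (0 : E n) 1, ⟪y, u⟫ ≤ h u}

theorem isClosed_wulffShape {n : ℕ} (h : E n → ℝ) : IsClosed (wulffShape h) := by
  simp only [wulffShape, Set.ofPred_forall]
  exact isClosed_biInter fun u _ => isClosed_le (by fun_prop) continuous_const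

theorem normalize_mem_sphere {n : ℕ} {x : E n} (hx : x ≠ 0) : ‖x‖⁻¹ • x ∈ sphere (0 : E n) 1 := by
  simp [norm_smul, hx]

theorem norm_smul_normalize {n : ℕ} (x : E n) : ‖x‖ • ‖x‖⁻¹ • x = x := by
  by_cases hx : x = 0
  · simp [hx]
  · rw [smul_smul, mul_inv_cancel₀ (norm_ne_zero_iff.2 hx), one_smul]

theorem isBounded_wulffShape {n : ℕ} {h : E n → ℝ} (hh : ContinuousOn h (sphere (0 : E n) 1)) :
    Bornology.IsBounded (wulffShape h) := by
  obtain ⟨M, hM⟩ := (isCompact_sphere (0 : E n) 1).bddAbove_image hh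
  refine isBounded_iff_forall_norm_le.2 ⟨max M 0, fun y hy => ?_⟩
  by_cases hy0 : y = 0
  · simp [hy0]
  have h1 := hy _ (normalize_mem_sphere hy0)
  rw [inner_smul_right, real_inner_self_eq_norm_sq, sq,
    inv_mul_cancel_left₀ (norm_ne_zero_iff.2 hy0)] at h1
  exact (h1.trans (hM ⟨_, normalize_mem_sphere hy0, rfl⟩)).trans (le_max_left _ _)

theorem volume_wulffShape_ne_top {n : ℕ} {h : E n → ℝ}
    (hh : ContinuousOn h (sphere (0 : E n) 1)) : volume (wulffShape h) ≠ ∞ :=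
  (isBounded_wulffShape hh).measure_lt_top.ne

theorem nonempty_sphere {n : ℕ} (hn : n ≠ 0) : (sphere (0 : E n) 1).Nonempty := by
  have : NeZero n := ⟨hn⟩
  exact ⟨EuclideanSpace.single 0 1, by simp⟩

namespace memC

variable {n : ℕ} {h : E n → ℝ}

theorem inner_gradient_le (hn : 2 ≤ n) (hh : memC n h) {u w : E n} (hu : u ∈ sphere (0 : E n) 1)
    (hw : w ∈ sphere (0 : E n) 1) : ⟪gradient h u, w⟫ ≤ h w := by
  rcases eq_or_ne u w with rfl | huw
  · exact (hh.inner_gradient_self (ne_zero_of_mem_unit_sphere ⟨u, hu⟩)).le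
  · exact (hh.inner_gradient_lt hn hu hw huw).le

theorem wulffShape_nonempty (hn : 2 ≤ n) (hh : memC n h) : (wulffShape h).Nonempty := by
  obtain ⟨e, he⟩ := nonempty_sphere (n := n) (by omega)
  exact ⟨gradient h e, fun u hu => hh.inner_gradient_le hn he hu⟩

theorem injOn_norm_smul_gradient (hn : 2 ≤ n) (hh : memC n h)
    (hpos : ∀ u ∈ sphere (0 : E n) 1, 0 < h u) :
    Set.InjOn (fun x => ‖x‖ • gradient h x) {0}ᶜ := by
  have key : ∀ x y : E n, x ≠ 0 → y ≠ 0 → ‖x‖ • gradient h (‖x‖⁻¹ • x) =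
      ‖y‖ • gradient h (‖y‖⁻¹ • y) → ‖x‖ ≤ ‖y‖ := by
    intro x y hx hy e
    have h1 := congrArg (fun v => ⟪v, ‖x‖⁻¹ • x⟫) e
    have hux := normalize_mem_sphere hx
    simp only [inner_smul_left, conj_trivial,
      hh.inner_gradient_self (ne_zero_of_mem_unit_sphere ⟨_, hux⟩)] at h1
    have h2 := hh.inner_gradient_le hn (normalize_mem_sphere hy) hux
    have h3 := hpos _ hux
    exact le_of_mul_le_mul_right
      (h1.le.trans (mul_le_mul_of_nonneg_left h2 (norm_nonneg y))) h3
  intro x hx y hy e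
  have hx0 : x ≠ 0 := hx
  have hy0 : y ≠ 0 := hy
  have hux := normalize_mem_sphere hx0
  have huy := normalize_mem_sphere hy0
  have hnx : 0 < ‖x‖ := norm_pos_iff.2 hx0
  have hny : 0 < ‖y‖ := norm_pos_iff.2 hy0
  simp only [← hh.gradient_smul hx0 (inv_pos.2 hnx),
    ← hh.gradient_smul hy0 (inv_pos.2 hny)] at e
  have hxy : ‖x‖ = ‖y‖ := le_antisymm (key x y hx0 hy0 e) (key y x hy0 hx0 e.symm)
  rw [hxy] at e
  have e' := smul_right_injective _ hny.ne' e
  have huv : ‖x‖⁻¹ • x = ‖y‖⁻¹ • y := by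
    by_contra hne
    have h1 := hh.inner_gradient_lt hn hux huy hne
    rw [hxy] at h1
    rw [e', hh.inner_gradient_self (ne_zero_of_mem_unit_sphere ⟨_, huy⟩)] at h1
    exact lt_irrefl _ h1
  rw [← norm_smul_normalize x, ← norm_smul_normalize y, huv, hxy]

theorem image_norm_smul_gradient (hn : 2 ≤ n) (hh : memC n h)
    (hpos : ∀ u ∈ sphere (0 : E n) 1, 0 < h u) :
    (fun x => ‖x‖ • gradient h x) '' (closedBall 0 1 \ {0}) = wulffShape h \ {0} := by
  ext y
  constructor
  · rintro ⟨x, ⟨hx1, hx⟩, rfl⟩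
    have hx0 : x ≠ 0 := hx
    have hx1' : ‖x‖ ≤ 1 := by simpa using hx1
    have hux := normalize_mem_sphere hx0
    simp only [← hh.gradient_smul hx0 (inv_pos.2 (norm_pos_iff.2 hx0))]
    refine ⟨fun w hw => ?_, fun h0 => ?_⟩
    · rw [inner_smul_left, conj_trivial]
      have h1 := hh.inner_gradient_le hn hux hw
      have h2 := hpos w hw
      nlinarith [norm_nonneg x]
    · have h1 := congrArg (fun v => ⟪v, ‖x‖⁻¹ • x⟫) (Set.mem_singleton_iff.1 h0)
      simp only [inner_smul_left, conj_trivial, inner_zero_left,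
        hh.inner_gradient_self (ne_zero_of_mem_unit_sphere ⟨_, hux⟩)] at h1
      exact (mul_pos (norm_pos_iff.2 hx0) (hpos _ hux)).ne' h1
  · rintro ⟨hy, hy0⟩
    have hy0 : y ≠ 0 := hy0
    have huy := normalize_mem_sphere hy0
    obtain ⟨u, hu, hmax⟩ := (isCompact_sphere (0 : E n) 1).exists_isMaxOn ⟨_, huy⟩
      (f := fun u => ⟪y, u⟫ / h u)
      ((by fun_prop : Continuous fun u : E n => ⟪y, u⟫).continuousOn.div hh.continuousOn
        fun u hu => (hpos u hu).ne')
    have hu0 : u ≠ 0 := ne_zero_of_mem_unit_sphere ⟨u, hu⟩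
    set r := ⟪y, u⟫ / h u with hr
    have hr0 : 0 < r := by
      have h1 := hmax huy
      refine lt_of_lt_of_le (div_pos ?_ (hpos _ huy)) h1
      rw [inner_smul_right, real_inner_self_eq_norm_sq]
      have := norm_pos_iff.2 hy0
      positivity
    have hr1 : r ≤ 1 := (div_le_one (hpos u hu)).2 (hy u hu)
    have hyu : ⟪y, u⟫ = r * h u := by rw [hr, div_mul_cancel₀ _ (hpos u hu).ne']
    have hyx : ∀ x : E n, x ≠ 0 → ⟪y, x⟫ ≤ r * h x := by
      intro x hx
      have h1 := (div_le_iff₀ (hpos _ (normalize_mem_sphere hx))).1 (hmax (normalize_mem_sphere hx))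
      rw [inner_smul_right, hh.1 _ (inv_pos.2 (norm_pos_iff.2 hx)), mul_left_comm] at h1
      exact le_of_mul_le_mul_left h1 (inv_pos.2 (norm_pos_iff.2 hx))
    have hmin : IsLocalMin (fun x => r * h x - ⟪y, x⟫) u := by
      filter_upwards [isOpen_compl_singleton.mem_nhds hu0] with x hx
      rw [hyu, sub_self]
      exact sub_nonneg.2 (hyx x hx)
    have hder : HasFDerivAt (fun x => r * h x - ⟪y, x⟫)
        (r • InnerProductSpace.toDual ℝ (E n) (gradient h u) - innerSL ℝ y) u :=
      ((hh.hasGradientAt hu0).hasFDerivAt.const_mul r).sub (innerSL ℝ y).hasFDerivAt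
    have hz := hmin.hasFDerivAt_eq_zero hder
    have hgr : r • gradient h u = y := by
      refine ext_inner_right ℝ fun v => ?_
      have := DFunLike.congr_fun hz v
      simp only [sub_apply, smul_apply, InnerProductSpace.toDual_apply_apply, innerSL_apply_apply,
        zero_apply, smul_eq_mul] at this
      rw [inner_smul_left, conj_trivial]
      linarith
    have hnr : ‖r • u‖ = r := by
      rw [norm_smul, Real.norm_of_nonneg hr0.le, mem_sphere_zero_iff_norm.1 hu, mul_one]
    refine ⟨r • u, ⟨by rw [mem_closedBall_zero_iff, hnr]; exact hr1,
      smul_ne_zero hr0.ne' hu0⟩, ?_⟩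
    simp only [hnr, hh.gradient_smul hu0 hr0, hgr]

theorem continuousOn_mul_sdet (hh : memC n h) :
    ContinuousOn (fun u => h u * sdet h u) (sphere (0 : E n) 1) :=
  hh.continuousOn.mul hh.continuousOn_sdet

theorem volume_wulffShape_of_pos (hn : 2 ≤ n) (hh : memC n h)
    (hpos : ∀ u ∈ sphere (0 : E n) 1, 0 < h u) :
    volume.real (wulffShape h) = ∫ u, h u * sdet h u ∂coneMeasure n := by
  have : NeZero n := ⟨by omega⟩
  have hs : MeasurableSet (closedBall (0 : E n) 1 \ {0}) :=
    isClosed_closedBall.measurableSet.diff (measurableSet_singleton 0)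
  have h1 := integral_image_eq_integral_abs_det_fderiv_smul (F := ℝ) volume hs
    (fun x hx => (hh.hasFDerivAt_norm_smul_gradient hx.2).hasFDerivWithinAt)
    ((hh.injOn_norm_smul_gradient hn hpos).mono fun x hx => hx.2) (fun _ => 1)
  rw [hh.image_norm_smul_gradient hn hpos] at h1
  have h2 : volume.real (wulffShape h) = volume.real (wulffShape h \ {0}) := by
    rw [measureReal_def, measureReal_def, measure_sdiff_null (measure_singleton _)]
  rw [h2, coneMeasure, integral_map (measurable_normalize _).aemeasurable]
  · simp only [setIntegral_const, smul_eq_mul, mul_one] at h1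
    rw [h1]
    refine setIntegral_congr_fun hs fun x hx => ?_
    have hux := normalize_mem_sphere (x := x) hx.2
    simp only [hh.det_sHess_add_gradient hux]
    exact abs_of_pos (mul_pos (hpos _ hux) (hh.sdet_pos hux))
  · exact ((isSphericallyInvariant_coneMeasure n).integrable
      hh.continuousOn_mul_sdet).aestronglyMeasurable

theorem hasGradientAt_add_inner (hh : memC n h) (a : E n) {x : E n} (hx : x ≠ 0) :
    HasGradientAt (fun y => h y + ⟪a, y⟫) (gradient h x + a) x := by
  have := (hh.hasGradientAt hx).hasFDerivAt.add (innerSL ℝ a).hasFDerivAt (x := x)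
  rw [hasGradientAt_iff_hasFDerivAt, map_add]
  exact this

theorem sHess_add_inner (hh : memC n h) (a : E n) {x : E n} (hx : x ≠ 0) :
    sHess (fun y => h y + ⟪a, y⟫) x = sHess h x := by
  have : gradient (fun y => h y + ⟪a, y⟫) =ᶠ[nhds x] fun y => gradient h y + a := by
    filter_upwards [isOpen_compl_singleton.mem_nhds hx] with y hy
    exact (hh.hasGradientAt_add_inner a hy).gradient
  rw [sHess, this.fderiv_eq, fderiv_add_const]
  rfl

theorem add_inner (hh : memC n h) (a : E n) : memC n fun y => h y + ⟪a, y⟫ := by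
  refine ⟨fun t ht x => ?_, ?_, fun u hu v hv hv0 => ?_⟩
  · simp only [hh.1 t ht, inner_smul_right]
    ring
  · exact hh.2.1.add (innerSL ℝ a).contDiff.contDiffOn
  · rw [hh.sHess_add_inner a (ne_zero_of_mem_unit_sphere ⟨u, hu⟩)]
    exact hh.2.2 u hu v hv hv0

theorem sdet_add_inner (hh : memC n h) (a : E n) {u : E n} (hu : u ∈ sphere (0 : E n) 1) :
    sdet (fun y => h y + ⟪a, y⟫) u = sdet h u := by
  rw [sdet, hh.sHess_add_inner a (ne_zero_of_mem_unit_sphere ⟨u, hu⟩), sdet]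

theorem hasGradientAt_convexComb {h₀ h₁ : E n → ℝ} (hh₀ : memC n h₀) (hh₁ : memC n h₁) (t : ℝ)
    {x : E n} (hx : x ≠ 0) : HasGradientAt (fun y => (1 - t) * h₀ y + t * h₁ y)
      ((1 - t) • gradient h₀ x + t • gradient h₁ x) x := by
  have := ((hh₀.hasGradientAt hx).hasFDerivAt.const_mul (1 - t)).add
    ((hh₁.hasGradientAt hx).hasFDerivAt.const_mul t)
  rw [hasGradientAt_iff_hasFDerivAt, map_add]
  simpa using! this

theorem sHess_convexComb {h₀ h₁ : E n → ℝ} (hh₀ : memC n h₀) (hh₁ : memC n h₁) (t : ℝ) {x : E n}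
    (hx : x ≠ 0) :
    sHess (fun y => (1 - t) * h₀ y + t * h₁ y) x = (1 - t) • sHess h₀ x + t • sHess h₁ x := by
  have : gradient (fun y => (1 - t) * h₀ y + t * h₁ y) =ᶠ[nhds x]
      fun y => (1 - t) • gradient h₀ y + t • gradient h₁ y := by
    filter_upwards [isOpen_compl_singleton.mem_nhds hx] with y hy
    exact (hh₀.hasGradientAt_convexComb hh₁ t hy).gradient
  rw [sHess, this.fderiv_eq]
  exact (((hh₀.hasFDerivAt_gradient hx).const_smul (1 - t)).add
    ((hh₁.hasFDerivAt_gradient hx).const_smul t)).fderiv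

theorem convexComb {h₀ h₁ : E n → ℝ} (hh₀ : memC n h₀) (hh₁ : memC n h₁) {t : ℝ} (ht₀ : 0 < t)
    (ht₁ : t < 1) : memC n fun y => (1 - t) * h₀ y + t * h₁ y := by
  refine ⟨fun s hs x => ?_, ?_, fun u hu v hv hv0 => ?_⟩
  · simp only [hh₀.1 s hs, hh₁.1 s hs]
    ring
  · exact (contDiffOn_const.mul hh₀.2.1).add (contDiffOn_const.mul hh₁.2.1)
  · rw [hh₀.sHess_convexComb hh₁ t (ne_zero_of_mem_unit_sphere ⟨u, hu⟩)]
    simp only [add_apply, smul_apply, inner_add_left, inner_smul_left, conj_trivial]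
    exact add_pos (mul_pos (sub_pos.2 ht₁) (hh₀.2.2 u hu v hv hv0))
      (mul_pos ht₀ (hh₁.2.2 u hu v hv hv0))

theorem exists_sub_inner_pos (hn : 2 ≤ n) (hh : memC n h) :
    ∃ a : E n, ∀ u ∈ sphere (0 : E n) 1, 0 < h u - ⟪a, u⟫ := by
  obtain ⟨e, he⟩ := nonempty_sphere (n := n) (by omega)
  have he' : -e ∈ sphere (0 : E n) 1 := by simpa using he
  refine ⟨(2⁻¹ : ℝ) • (gradient h e + gradient h (-e)), fun u hu => ?_⟩
  rw [inner_smul_left, inner_add_left, conj_trivial]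
  have h1 := hh.inner_gradient_le hn he hu
  have h2 := hh.inner_gradient_le hn he' hu
  by_cases heu : e = u
  · have hne : -e ≠ u := fun h' =>
      ne_neg_of_mem_unit_sphere ℝ ⟨e, he⟩ (Subtype.ext (heu.trans h'.symm))
    have := hh.inner_gradient_lt hn he' hu hne
    linarith
  · have := hh.inner_gradient_lt hn he hu heu
    linarith

theorem integral_add_inner (hh : memC n h) (a : E n) :
    ∫ u, (h u + ⟪a, u⟫) * sdet (fun y => h y + ⟪a, y⟫) u ∂coneMeasure n =
      (∫ u, h u * sdet h u ∂coneMeasure n) + ∫ u, ⟪a, u⟫ * sdet h u ∂coneMeasure n := by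
  have hc := isSphericallyInvariant_coneMeasure n
  have ha : ContinuousOn (fun u => ⟪a, u⟫ * sdet h u) (sphere (0 : E n) 1) :=
    (by fun_prop : Continuous fun u : E n => ⟪a, u⟫).continuousOn.mul hh.continuousOn_sdet
  rw [← integral_add (hc.integrable hh.continuousOn_mul_sdet) (hc.integrable ha)]
  refine integral_congr_ae ?_
  filter_upwards [hc.ae_mem] with u hu
  rw [hh.sdet_add_inner a hu, add_mul]

end memC

theorem wulffShape_add_inner {n : ℕ} (h : E n → ℝ) (a : E n) :
    wulffShape (fun y => h y + ⟪a, y⟫) = (fun y => a + y) '' wulffShape h := by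
  ext y
  simp only [Set.image_add_left, Set.mem_preimage, wulffShape, Set.mem_ofPred_eq, inner_add_left,
    inner_neg_left]
  refine forall₂_congr fun u _ => ?_
  constructor <;> intro <;> linarith

theorem volume_wulffShape_add_inner {n : ℕ} (h : E n → ℝ) (a : E n) :
    volume.real (wulffShape fun y => h y + ⟪a, y⟫) = volume.real (wulffShape h) := by
  rw [wulffShape_add_inner, measureReal_def, measureReal_def, Set.image_add_left,
    measure_preimage_add]

namespace memC

variable {n : ℕ} {h : E n → ℝ}

theorem integral_inner_mul_sdet_of_pos (hn : 2 ≤ n) (hh : memC n h)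
    (hpos : ∀ u ∈ sphere (0 : E n) 1, 0 < h u) (a : E n) :
    ∫ u, ⟪a, u⟫ * sdet h u ∂coneMeasure n = 0 := by
  obtain ⟨v, hv, hmin⟩ := (isCompact_sphere (0 : E n) 1).exists_isMinOn
    (nonempty_sphere (by omega)) hh.continuousOn
  have hm := hpos v hv
  have hd : 0 < ‖a‖ + 1 := by positivity
  set s := h v / (‖a‖ + 1) with hs
  have hs0 : 0 < s := div_pos hm hd
  have hpos' : ∀ u ∈ sphere (0 : E n) 1, 0 < h u + ⟪s • a, u⟫ := by
    intro u hu
    have h1 : h v ≤ h u := hmin hu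
    have h2 := abs_le.1 (abs_real_inner_le_norm a u)
    rw [mem_sphere_zero_iff_norm.1 hu, mul_one] at h2
    have h3 : s * (‖a‖ + 1) = h v := div_mul_cancel₀ _ hd.ne'
    rw [inner_smul_left, conj_trivial]
    nlinarith [mul_le_mul_of_nonneg_left h2.1 hs0.le]
  have h1 := (hh.add_inner (s • a)).volume_wulffShape_of_pos hn hpos'
  rw [volume_wulffShape_add_inner, hh.volume_wulffShape_of_pos hn hpos,
    hh.integral_add_inner (s • a)] at h1
  simp only [inner_smul_left, conj_trivial, mul_assoc, integral_const_mul] at h1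
  have h2 : s * ∫ u, ⟪a, u⟫ * sdet h u ∂coneMeasure n = 0 := by linarith
  exact (mul_eq_zero.1 h2).resolve_left hs0.ne'

theorem volume_wulffShape (hn : 2 ≤ n) (hh : memC n h) :
    volume.real (wulffShape h) = ∫ u, h u * sdet h u ∂coneMeasure n := by
  obtain ⟨a, ha⟩ := hh.exists_sub_inner_pos hn
  have hh' := hh.add_inner (-a)
  have hpos : ∀ u ∈ sphere (0 : E n) 1, 0 < h u + ⟪-a, u⟫ := by
    simpa only [inner_neg_left, ← sub_eq_add_neg] using ha
  have e : (fun y => (h y + ⟪-a, y⟫) + ⟪a, y⟫) = h := by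
    ext y; simp
  have h1 := hh'.integral_add_inner a
  have h2 := volume_wulffShape_add_inner (fun y => h y + ⟪-a, y⟫) a
  rw [hh'.integral_inner_mul_sdet_of_pos hn hpos, add_zero,
    ← hh'.volume_wulffShape_of_pos hn hpos, ← h2] at h1
  simp only [neg_add_cancel_right, inner_neg_left] at h1
  exact h1.symm

end memC

theorem exists_volF_eq_mul_volume {n : ℕ} (hn : 2 ≤ n) :
    ∃ c : ℝ, 0 ≤ c ∧ ∀ h, memC n h → volF n h = c * volume.real (wulffShape h) := by
  obtain ⟨m, rfl⟩ : ∃ m, n = m + 1 := ⟨n - 1, by omega⟩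
  have e : ((m + 1 : ℕ) : ℝ) - 1 = m := by push_cast; ring
  have : IsFiniteMeasure ((μH[(m : ℝ)] : Measure (E (m + 1))).restrict (sphere 0 1)) :=
    ⟨by rw [Measure.restrict_apply_univ]; exact hausdorffMeasure_sphere_lt_top m⟩
  refine ⟨(1 / (m + 1 : ℕ) : ℝ) *
    (((μH[(m : ℝ)] : Measure (E (m + 1))).restrict (sphere 0 1)).real Set.univ /
      (coneMeasure (m + 1)).real Set.univ), by positivity, fun h hh => ?_⟩
  rw [volF, e, hh.volume_wulffShape hn, mul_assoc,
    (isSphericallyInvariant_hausdorffMeasure (m : ℝ)).integral_eq_mul_integral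
      (isSphericallyInvariant_coneMeasure (m + 1)) (coneMeasure_ne_zero (by omega))
      hh.continuousOn_mul_sdet]

/-- Proposition 2.1: (a consequence of the Brunn-Minkowski inequality) the functional
`F^{1/n}` is concave on `𝒞`: for all `h₀, h₁ ∈ 𝒞` and `t ∈ [0,1]`,
`F^{1/n}((1-t) h₀ + t h₁) ≥ (1-t) F^{1/n}(h₀) + t F^{1/n}(h₁)`. -/
theorem volF_rpow_concave
    {n : ℕ} (hn : 2 ≤ n) (h₀ h₁ : E n → ℝ) (hh₀ : memC n h₀) (hh₁ : memC n h₁)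
    (t : ℝ) (ht : t ∈ Set.Icc (0 : ℝ) 1) :
    (1 - t) * (volF n h₀) ^ ((1 : ℝ) / n) + t * (volF n h₁) ^ ((1 : ℝ) / n)
      ≤ (volF n (fun x => (1 - t) * h₀ x + t * h₁ x)) ^ ((1 : ℝ) / n) := by
  rcases ht.1.eq_or_lt with rfl | ht₀
  · simp
  rcases ht.2.eq_or_lt with rfl | ht₁
  · simp
  obtain ⟨c, hc, hF⟩ := exists_volF_eq_mul_volume hn
  have hh := hh₀.convexComb hh₁ ht₀ ht₁
  rw [hF _ hh₀, hF _ hh₁, hF _ hh, Real.mul_rpow hc measureReal_nonneg,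
    Real.mul_rpow hc measureReal_nonneg, Real.mul_rpow hc measureReal_nonneg]
  have hBM := brunn_minkowski (n := n) (by omega) ht₀ ht₁
    (isClosed_wulffShape h₀).measurableSet (isClosed_wulffShape h₁).measurableSet
    (isClosed_wulffShape _).measurableSet (volume_wulffShape_ne_top hh.continuousOn)
    (hh₀.wulffShape_nonempty hn) (hh₁.wulffShape_nonempty hn) fun a ha b hb u hu => by
      simp only [inner_add_left, inner_smul_left, conj_trivial]
      exact add_le_add (mul_le_mul_of_nonneg_left (ha u hu) (sub_pos.2 ht₁).le)
        (mul_le_mul_of_nonneg_left (hb u hu) ht₀.le)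
  calc _ = c ^ ((1 : ℝ) / n) * ((1 - t) * volume.real (wulffShape h₀) ^ ((1 : ℝ) / n) +
        t * volume.real (wulffShape h₁) ^ ((1 : ℝ) / n)) := by ring
    _ ≤ _ := mul_le_mul_of_nonneg_left hBM (Real.rpow_nonneg hc _)
end
end

section
/- Let h ∈ 𝒞, φ ∈ C^∞(S^{n-1}), and ε > 0 be such that h + sφ ∈ 𝒞 for every s ∈ (-ε, ε). Set h_s = h + sφ and f(s) = F(h_s). Then for every s ∈ (-ε, ε), f'(s) = ∫_{S^{n-1}} φ det((h_s)_ij + h_s δ_ij) dℋ^{n-1}. -/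
open MeasureTheory Metric
open scoped RealInnerProductSpace ENNReal

noncomputable section

open Function Filter Topology

/-- The standard orthonormal basis of Euclidean space. -/
abbrev stdE (n : ℕ) (i : Fin n) : E n := EuclideanSpace.basisFun (Fin n) ℝ i

/-- The determinant of an `n`-tuple of vectors, as a continuous alternating map. -/
def detC (n : ℕ) : E n [⋀^Fin n]→L[ℝ] ℝ :=
  { (EuclideanSpace.basisFun (Fin n) ℝ).toBasis.det with
    cont := by
      change Continuous fun v : Fin n → E n => (EuclideanSpace.basisFun (Fin n) ℝ).toBasis.det v
      simp only [Module.Basis.det_apply]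
      refine Continuous.matrix_det (continuous_matrix fun i j => ?_)
      simp only [Module.Basis.toMatrix_apply, OrthonormalBasis.coe_toBasis_repr_apply,
        EuclideanSpace.basisFun_repr]
      fun_prop }

lemma detC_eq_matrix_det {n : ℕ} (v : Fin n → E n) :
    detC n v = Matrix.det (Matrix.of fun i j => v i j) := by
  change (EuclideanSpace.basisFun (Fin n) ℝ).toBasis.det v = _
  rw [Module.Basis.det_apply, ← Matrix.det_transpose]
  congr 1

lemma detC_comp_stdE {n : ℕ} (L : E n →L[ℝ] E n) :
    detC n (fun i => L (stdE n i)) = LinearMap.det (L : E n →ₗ[ℝ] E n) := by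
  change (EuclideanSpace.basisFun (Fin n) ℝ).toBasis.det _ = _
  have := (EuclideanSpace.basisFun (Fin n) ℝ).toBasis.det_comp (L : E n →ₗ[ℝ] E n)
    (EuclideanSpace.basisFun (Fin n) ℝ).toBasis
  rw [Module.Basis.det_self, mul_one] at this
  rw [← this]
  congr 1

lemma HasDerivAt.detC_comp {n : ℕ} {v : ℝ → Fin n → E n} {v' : Fin n → E n} {t : ℝ}
    (hv : HasDerivAt v v' t) :
    HasDerivAt (fun s => detC n (v s)) (∑ j, detC n (update (v t) j (v' j))) t := by
  refine (((detC n).hasFDerivAt (v t)).comp_hasDerivAt t hv).congr_deriv ?_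
  simp [ContinuousMultilinearMap.linearDeriv_apply]

lemma detC_update_add_smul {n : ℕ} (A : Fin n → E n) (c : Fin n → ℝ) (q : E n) (j : Fin n) :
    detC n (update (fun i => A i + c i • q) j q) = detC n (update A j q) := by
  rw [detC_eq_matrix_det, detC_eq_matrix_det]
  refine Matrix.det_eq_of_forall_row_eq_smul_add_const (update c j 0) j (by simp) fun i k => ?_
  by_cases h : i = j
  · subst h; simp
  · simp [h]

/-- The determinant of a rank-one perturbation. -/
lemma detC_add_smul {n : ℕ} (A : Fin n → E n) (c : Fin n → ℝ) (q : E n) :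
    detC n (fun i => A i + c i • q) = detC n A + ∑ j, c j * detC n (update A j q) := by
  have h : ∀ t : ℝ, HasDerivAt (fun s : ℝ => detC n (fun i => A i + (s * c i) • q) -
      s * ∑ j, c j * detC n (update A j q)) 0 t := by
    intro t
    have h1 : HasDerivAt (fun (s : ℝ) (i : Fin n) => A i + (s * c i) • q) (fun i => c i • q) t := by
      rw [hasDerivAt_pi]
      intro i
      simpa using (((hasDerivAt_id t).mul_const (c i)).smul_const q).const_add (A i)
    have h2 := h1.detC_comp.sub ((hasDerivAt_id t).mul_const (∑ j, c j * detC n (update A j q)))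
    refine h2.congr_deriv ?_
    simp [ContinuousAlternatingMap.map_update_smul, detC_update_add_smul]
  have := is_const_of_deriv_eq_zero (fun t => (h t).differentiableAt) (fun t => (h t).deriv) 1 0
  simp at this
  linarith

lemma sum_smul_stdE {n : ℕ} (u : E n) : ∑ i, u i • stdE n i = u := by
  exact (EuclideanSpace.basisFun (Fin n) ℝ).sum_repr u

lemma sum_sq_eq_one {n : ℕ} {u : E n} (hu : ‖u‖ = 1) : ∑ i, u i * u i = 1 := by
  have := EuclideanSpace.real_norm_sq_eq u
  rw [hu] at this
  simpa [pow_two] using this.symm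

lemma inner_stdE {n : ℕ} (u : E n) (i : Fin n) : ⟪u, stdE n i⟫ = u i := by
  rw [real_inner_comm]
  exact (EuclideanSpace.basisFun (Fin n) ℝ).repr_apply_apply u i ▸ rfl

/-- The endomorphism with value `p` at the unit vector `u` that agrees with `L` on `u^⊥`. -/
def replaceNormal {n : ℕ} (L : E n →L[ℝ] E n) (p u : E n) : E n →L[ℝ] E n :=
  L.comp (tproj u) + (innerSL ℝ u).smulRight p

lemma tproj_apply {n : ℕ} (u v : E n) : tproj u v = v - ⟪u, v⟫ • u := by
  simp [tproj]

lemma replaceNormal_apply {n : ℕ} (L : E n →L[ℝ] E n) (p u v : E n) :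
    replaceNormal L p u v = L (v - ⟪u, v⟫ • u) + ⟪u, v⟫ • p := by
  simp [replaceNormal, tproj_apply]

lemma detC_update_sum {n : ℕ} {ι : Type*} (t : Finset ι) (v : Fin n → E n) (j : Fin n)
    (g : ι → E n) :
    detC n (update v j (∑ k ∈ t, g k)) = ∑ k ∈ t, detC n (update v j (g k)) :=
  (detC n).toMultilinearMap.map_update_sum t j g v

lemma detC_update_apply_unit {n : ℕ} (L : E n →L[ℝ] E n) (u : E n) (j : Fin n) :
    detC n (update (fun i => L (stdE n i)) j (L u)) = u j * detC n (fun i => L (stdE n i)) := by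
  conv_lhs => rw [← sum_smul_stdE u]
  rw [map_sum, detC_update_sum, Finset.sum_eq_single j]
  · simp [ContinuousAlternatingMap.map_update_smul]
  · intro k _ hk
    rw [map_smul, ContinuousAlternatingMap.map_update_smul]
    exact (congrArg (u k • ·) ((detC n).map_update_self (fun i => L (stdE n i)) hk.symm)).trans
      (smul_zero _)
  · simp

lemma detC_replaceNormal {n : ℕ} (L : E n →L[ℝ] E n) (p : E n) {u : E n} (hu : ‖u‖ = 1) :
    detC n (fun i => replaceNormal L p u (stdE n i)) =
      ∑ j, u j * detC n (update (fun i => L (stdE n i)) j p) := by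
  have h1 : (fun i => replaceNormal L p u (stdE n i)) =
      fun i => L (stdE n i) + u i • (p - L u) := by
    ext1 i
    rw [replaceNormal_apply, inner_stdE]
    simp only [map_sub, map_smul, smul_sub]
    abel
  rw [h1, detC_add_smul]
  simp only [ContinuousAlternatingMap.map_update_sub, detC_update_apply_unit, mul_sub,
    Finset.sum_sub_distrib, ← mul_assoc]
  rw [← Finset.sum_mul, sum_sq_eq_one hu]
  ring

lemma replaceNormal_replaceNormal {n : ℕ} (L : E n →L[ℝ] E n) (p q : E n) {u : E n}
    (hu : ‖u‖ = 1) : replaceNormal (replaceNormal L q u) p u = replaceNormal L p u := by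
  ext1 v
  simp [replaceNormal_apply, inner_sub_right, inner_smul_right, hu]

/-- If `L` has range in `u^⊥`, then replacing its value at `u` by `p` gives determinant
`⟪p, u⟫ det (L|_{u^⊥})`. -/
lemma det_replaceNormal {n : ℕ} (L : E n →L[ℝ] E n) (p : E n) {u : E n} (hu : ‖u‖ = 1)
    (hL : ∀ v, ⟪L v, u⟫ = 0) :
    LinearMap.det (replaceNormal L p u : E n →ₗ[ℝ] E n) =
      ⟪p, u⟫ * LinearMap.det (((tproj u).comp (L.comp (tproj u)) + (innerSL ℝ u).smulRight u :
        E n →L[ℝ] E n) : E n →ₗ[ℝ] E n) := by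
  have h1 : (replaceNormal L p u : E n →ₗ[ℝ] E n) =
      (LinearMap.transvection ((innerSL ℝ u : E n →L[ℝ] ℝ) : E n →ₗ[ℝ] ℝ) (p - u)) ∘ₗ
      (((tproj u).comp (L.comp (tproj u)) + (innerSL ℝ u).smulRight u :
        E n →L[ℝ] E n) : E n →ₗ[ℝ] E n) := by
    ext1 v
    have hL' : ∀ v, ⟪u, L v⟫ = 0 := fun v => by rw [real_inner_comm]; exact hL v
    simp [replaceNormal_apply, tproj_apply, LinearMap.transvection.apply, inner_sub_right,
      inner_add_right, inner_smul_right, hu, hL']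
    simp only [smul_sub]
    abel
  rw [h1, LinearMap.det_comp, LinearMap.transvection.det]
  simp [inner_sub_right, hu, real_inner_comm]

/-- The `(n-1)`-dimensional Hausdorff measure on the unit sphere of `ℝⁿ`. -/
def sphereH (n : ℕ) : Measure (E n) := μH[(n : ℝ) - 1].restrict (sphere (0 : E n) 1)

lemma ae_mem_sphere (n : ℕ) : ∀ᵐ u ∂sphereH n, u ∈ sphere (0 : E n) 1 :=
  ae_restrict_mem isClosed_sphere.measurableSet

lemma measurePreserving_sphereH {n : ℕ} (R : E n ≃ₗᵢ[ℝ] E n) :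
    MeasurePreserving R (sphereH n) (sphereH n) := by
  have h := (R.toIsometryEquiv.measurePreserving_hausdorffMeasure ((n : ℝ) - 1)).restrict_preimage
    (isClosed_sphere (x := (0 : E n)) (ε := 1)).measurableSet
  have h2 : R.toIsometryEquiv ⁻¹' sphere (0 : E n) 1 = sphere (0 : E n) 1 := by
    ext x; simp
  rw [h2] at h
  exact h

/-- The central chart of the unit sphere on one of the faces of the cube. -/
def faceChart {m : ℕ} (k : Fin (m + 1)) (c : ℝ) (y : Fin m → ℝ) : E (m + 1) :=
  ‖(WithLp.toLp 2 (k.insertNth c y : Fin (m + 1) → ℝ) : E (m + 1))‖⁻¹ •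
    (WithLp.toLp 2 (k.insertNth c y : Fin (m + 1) → ℝ) : E (m + 1))

lemma contDiff_faceChart {m : ℕ} (k : Fin (m + 1)) {c : ℝ} (hc : c ≠ 0) :
    ContDiff ℝ 1 (faceChart k c) := by
  have h : ContDiff ℝ 1 fun y : Fin m → ℝ =>
      (WithLp.toLp 2 (k.insertNth c y : Fin (m + 1) → ℝ) : E (m + 1)) := by
    rw [contDiff_euclidean]
    intro i
    refine k.succAboveCases ?_ (fun j => ?_) i
    · simpa using contDiff_const
    · simpa using contDiff_apply ℝ ℝ j
  refine ContDiff.smul ((h.norm ℝ fun y hy => hc ?_).inv fun y hy => hc ?_) h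
  · simpa using congrArg (fun x : E (m + 1) => x k) hy
  · simpa using congrArg (fun x : E (m + 1) => x k) (norm_eq_zero.1 hy)

lemma sphere_subset_faceChart (m : ℕ) :
    sphere (0 : E (m + 1)) 1 ⊆ ⋃ k : Fin (m + 1), ⋃ c ∈ ({1, -1} : Set ℝ),
      faceChart k c '' Set.pi Set.univ fun _ => Set.Icc (-1) 1 := by
  intro u hu
  have hu1 : ‖u‖ = 1 := by simpa using hu
  obtain ⟨k, hk⟩ := Finite.exists_max fun i => |u i|
  have hk0 : 0 < |u k| := by
    rcases (abs_nonneg (u k)).eq_or_lt with h | h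
    · exfalso
      have : u = 0 := by
        ext i
        exact abs_eq_zero.1 (le_antisymm ((hk i).trans h.symm.le) (abs_nonneg _))
      simp [this] at hu1
    · exact h
  have huk : u k ≠ 0 := abs_pos.1 hk0
  have hins : (WithLp.toLp 2 (k.insertNth (u k / |u k|) (fun j => u (k.succAbove j) / |u k|) :
      Fin (m + 1) → ℝ) : E (m + 1)) = |u k|⁻¹ • u := by
    ext i
    refine k.succAboveCases ?_ (fun j => ?_) i
    · simp [div_eq_inv_mul]
    · simp [div_eq_inv_mul]
  refine Set.mem_iUnion.2 ⟨k, Set.mem_iUnion₂.2 ⟨u k / |u k|, ?_,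
    fun j => u (k.succAbove j) / |u k|, ?_, ?_⟩⟩
  · rcases lt_or_gt_of_ne huk with h | h
    · right; simp [abs_of_neg h, huk]
    · left; simp [abs_of_pos h, huk]
  · intro j _
    refine abs_le.1 ?_
    rw [abs_div, abs_abs, div_le_one hk0]
    exact hk _
  · rw [faceChart, hins, norm_smul, hu1, mul_one, norm_inv, norm_abs_eq_norm, inv_inv, smul_smul,
      Real.norm_eq_abs, mul_inv_cancel₀ hk0.ne', one_smul]

lemma isFiniteMeasure_sphereH {n : ℕ} (hn : n ≠ 0) : IsFiniteMeasure (sphereH n) := by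
  obtain ⟨m, rfl⟩ := Nat.exists_eq_succ_of_ne_zero hn
  refine ⟨?_⟩
  rw [sphereH, Measure.restrict_apply_univ]
  have hd : ((m + 1 : ℕ) : ℝ) - 1 = Fintype.card (Fin m) := by simp
  have hfin : ∀ (k : Fin (m + 1)) (c : ℝ), c ≠ 0 →
      μH[((m + 1 : ℕ) : ℝ) - 1] (faceChart k c '' Set.pi Set.univ fun _ => Set.Icc (-1) 1) < ∞ := by
    intro k c hc
    have hcpt : IsCompact (Set.pi Set.univ fun _ : Fin m => Set.Icc (-1 : ℝ) 1) :=
      isCompact_univ_pi fun _ => isCompact_Icc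
    obtain ⟨K, hK⟩ := hcpt.exists_bound_of_continuousOn
      ((contDiff_faceChart k hc).continuous_fderiv one_ne_zero).continuousOn
    have hL : LipschitzOnWith K.toNNReal (faceChart k c)
        (Set.pi Set.univ fun _ : Fin m => Set.Icc (-1 : ℝ) 1) :=
      (convex_pi fun _ _ => convex_Icc _ _).lipschitzOnWith_of_nnnorm_fderiv_le
        (fun x _ => ((contDiff_faceChart k hc).differentiable one_ne_zero) x) fun x hx => by
          rw [← NNReal.coe_le_coe, coe_nnnorm]
          exact (hK x hx).trans (Real.le_coe_toNNReal K)
    rw [hd]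
    refine (hL.hausdorffMeasure_image_le (Nat.cast_nonneg _)).trans_lt ?_
    rw [hausdorffMeasure_pi_real]
    exact ENNReal.mul_lt_top (ENNReal.rpow_lt_top_of_nonneg (Nat.cast_nonneg _) ENNReal.coe_ne_top)
      hcpt.measure_lt_top
  refine (measure_mono (sphere_subset_faceChart m)).trans_lt ?_
  refine (measure_iUnion_le _).trans_lt ?_
  rw [tsum_fintype]
  refine ENNReal.sum_lt_top.2 fun k _ => ?_
  refine (measure_biUnion_lt_top (Set.toFinite _) ?_)
  rintro c hc
  refine hfin k c ?_
  rcases hc with rfl | rfl <;> norm_num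

lemma integrable_sphereH {n : ℕ} (hn : n ≠ 0) {f : E n → ℝ}
    (hf : ContinuousOn f (sphere (0 : E n) 1)) : Integrable f (sphereH n) := by
  have := isFiniteMeasure_sphereH hn
  have h : (sphereH n).restrict (sphere (0 : E n) 1) = sphereH n :=
    Measure.restrict_eq_self_of_ae_mem (ae_mem_sphere n)
  rw [← h]
  exact hf.integrableOn_compact (isCompact_sphere _ _)

lemma aestronglyMeasurable_sphereH {n : ℕ} {F : Type*} [TopologicalSpace F]
    [TopologicalSpace.PseudoMetrizableSpace F] {f : E n → F}
    (hf : ContinuousOn f (sphere (0 : E n) 1)) : AEStronglyMeasurable f (sphereH n) :=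
  hf.aestronglyMeasurable_of_isCompact (isCompact_sphere _ _) isClosed_sphere.measurableSet

lemma sphere_subset_compl_zero (n : ℕ) : sphere (0 : E n) 1 ⊆ {(0 : E n)}ᶜ := fun x hx h => by
  rw [Set.mem_singleton_iff] at h; simp [h] at hx

/-- Euler's identity. -/
lemma homog1.fderiv_apply_self {n : ℕ} {g : E n → ℝ} (hg : homog1 g) {x : E n}
    (hd : DifferentiableAt ℝ g x) : fderiv ℝ g x x = g x := by
  have h1 : HasDerivAt (fun t : ℝ => g (t • x)) (fderiv ℝ g x x) 1 := by
    have hl : HasDerivAt (fun t : ℝ => t • x) x 1 := by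
      simpa using (hasDerivAt_id (1 : ℝ)).smul_const x
    have hd' : HasFDerivAt g (fderiv ℝ g x) ((1 : ℝ) • x) := by simpa using hd.hasFDerivAt
    exact hd'.comp_hasDerivAt (1 : ℝ) hl
  have h2 : HasDerivAt (fun t : ℝ => g (t • x)) (g x) 1 := by
    have hl : HasDerivAt (fun t : ℝ => t * g x) (g x) 1 := by
      simpa using (hasDerivAt_id (1 : ℝ)).mul_const (g x)
    refine hl.congr_of_eventuallyEq ?_
    filter_upwards [lt_mem_nhds (zero_lt_one' ℝ)] with t ht using hg t ht x
  exact h1.unique h2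

/-- The rotation by the angle `t` in the plane spanned by the orthonormal vectors `a`, `b`. -/
def planeRotation {n : ℕ} (a b : E n) (t : ℝ) : E n →L[ℝ] E n :=
  ContinuousLinearMap.id ℝ (E n) +
    (Real.cos t - 1) • ((innerSL ℝ a).smulRight a + (innerSL ℝ b).smulRight b) +
    Real.sin t • ((innerSL ℝ a).smulRight b - (innerSL ℝ b).smulRight a)

lemma planeRotation_apply {n : ℕ} (a b : E n) (t : ℝ) (x : E n) :
    planeRotation a b t x = x + (Real.cos t - 1) • (⟪a, x⟫ • a + ⟪b, x⟫ • b) +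
      Real.sin t • (⟪a, x⟫ • b - ⟪b, x⟫ • a) := by
  simp [planeRotation]

lemma norm_planeRotation {n : ℕ} {a b : E n} (ha : ‖a‖ = 1) (hb : ‖b‖ = 1) (hab : ⟪a, b⟫ = 0)
    (t : ℝ) (x : E n) : ‖planeRotation a b t x‖ = ‖x‖ := by
  have hba : ⟪b, a⟫ = 0 := by rw [real_inner_comm, hab]
  have haa : ⟪a, a⟫ = 1 := by simp [ha]
  have hbb : ⟪b, b⟫ = 1 := by simp [hb]
  have h : ⟪planeRotation a b t x, planeRotation a b t x⟫ = ⟪x, x⟫ := by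
    rw [planeRotation_apply]
    simp only [inner_add_left, inner_add_right, inner_sub_left, inner_sub_right, inner_smul_left,
      inner_smul_right, hab, hba, haa, hbb, real_inner_comm a x, real_inner_comm b x,
      conj_trivial]
    linear_combination (⟪a, x⟫ ^ 2 + ⟪b, x⟫ ^ 2) * Real.sin_sq_add_cos_sq t
  rw [← sq_eq_sq₀ (norm_nonneg _) (norm_nonneg _), ← real_inner_self_eq_norm_sq,
    ← real_inner_self_eq_norm_sq, h]

lemma integral_planeRotation {n : ℕ} {a b : E n} (ha : ‖a‖ = 1) (hb : ‖b‖ = 1)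
    (hab : ⟪a, b⟫ = 0) (t : ℝ) (g : E n → ℝ) :
    ∫ x, g (planeRotation a b t x) ∂sphereH n = ∫ x, g x ∂sphereH n := by
  let R : E n →ₗᵢ[ℝ] E n := ⟨planeRotation a b t, norm_planeRotation ha hb hab t⟩
  exact (measurePreserving_sphereH (R.toLinearIsometryEquiv rfl)).integral_comp
    (R.toLinearIsometryEquiv rfl).toHomeomorph.measurableEmbedding g

lemma hasDerivAt_planeRotation {n : ℕ} (a b x : E n) (t : ℝ) :
    HasDerivAt (fun s => planeRotation a b s x)
      (-Real.sin t • (⟪a, x⟫ • a + ⟪b, x⟫ • b) + Real.cos t • (⟪a, x⟫ • b - ⟪b, x⟫ • a)) t := by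
  simp only [planeRotation_apply]
  exact (((Real.hasDerivAt_cos t).sub_const 1).smul_const _).const_add x |>.add
    ((Real.hasDerivAt_sin t).smul_const _)

/-- The infinitesimal form of the rotation invariance of the Hausdorff measure on the sphere. -/
lemma integral_fderiv_rotation {n : ℕ} (hn : n ≠ 0) {a b : E n} (ha : ‖a‖ = 1) (hb : ‖b‖ = 1)
    (hab : ⟪a, b⟫ = 0) {g : E n → ℝ} (hg : ContDiffOn ℝ 1 g {(0 : E n)}ᶜ) :
    ∫ x, fderiv ℝ g x (⟪a, x⟫ • b - ⟪b, x⟫ • a) ∂sphereH n = 0 := by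
  have hfin := isFiniteMeasure_sphereH hn
  have hsub := sphere_subset_compl_zero n
  have hg' : ContinuousOn (fderiv ℝ g) (sphere (0 : E n) 1) :=
    (hg.continuousOn_fderiv_of_isOpen isOpen_compl_singleton le_rfl).mono hsub
  have hgc : ContinuousOn g (sphere (0 : E n) 1) := hg.continuousOn.mono hsub
  obtain ⟨C, hC⟩ := (isCompact_sphere (0 : E n) 1).exists_bound_of_continuousOn hg'
  have hmaps : ∀ t, Set.MapsTo (planeRotation a b t) (sphere (0 : E n) 1) (sphere (0 : E n) 1) :=
    fun t x hx => by simpa [norm_planeRotation ha hb hab] using hx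
  have key := hasDerivAt_integral_of_dominated_loc_of_deriv_le (μ := sphereH n)
    (F := fun t x => g (planeRotation a b t x)) (x₀ := (0 : ℝ)) (s := Set.univ)
    (bound := fun _ => C * 4)
    (F' := fun t x => fderiv ℝ g (planeRotation a b t x)
      (-Real.sin t • (⟪a, x⟫ • a + ⟪b, x⟫ • b) + Real.cos t • (⟪a, x⟫ • b - ⟪b, x⟫ • a)))
    univ_mem
    (Eventually.of_forall fun t => aestronglyMeasurable_sphereH
      (hgc.comp (planeRotation a b t).continuous.continuousOn (hmaps t)))
    (integrable_sphereH hn (hgc.comp (planeRotation a b 0).continuous.continuousOn (hmaps 0)))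
    (aestronglyMeasurable_sphereH
      ((hg'.comp (planeRotation a b 0).continuous.continuousOn (hmaps 0)).clm_apply
        (by fun_prop)))
    ?_ (integrable_const _) ?_
  · simp only [integral_planeRotation ha hb hab] at key
    have h0 := key.2.unique (hasDerivAt_const (0 : ℝ) _)
    simpa [planeRotation_apply] using h0
  · filter_upwards [ae_mem_sphere n] with x hx t _
    have hx1 : ‖x‖ = 1 := by simpa using hx
    refine (ContinuousLinearMap.le_opNorm _ _).trans ?_
    refine mul_le_mul (hC _ (hmaps t hx)) ?_ (norm_nonneg _)
      ((norm_nonneg _).trans (hC _ (hmaps t hx)))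
    have h1 : ‖⟪a, x⟫‖ ≤ 1 := by simpa [ha, hx1] using norm_inner_le_norm (𝕜 := ℝ) a x
    have h2 : ‖⟪b, x⟫‖ ≤ 1 := by simpa [hb, hx1] using norm_inner_le_norm (𝕜 := ℝ) b x
    have hs : ‖-Real.sin t‖ ≤ 1 := by simpa using Real.abs_sin_le_one t
    have hc : ‖Real.cos t‖ ≤ 1 := by simpa using Real.abs_cos_le_one t
    have e1 : ‖⟪a, x⟫ • a + ⟪b, x⟫ • b‖ ≤ 2 := by
      refine (norm_add_le _ _).trans ?_
      rw [norm_smul, norm_smul, ha, hb]; linarith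
    have e2 : ‖⟪a, x⟫ • b - ⟪b, x⟫ • a‖ ≤ 2 := by
      refine (norm_sub_le _ _).trans ?_
      rw [norm_smul, norm_smul, ha, hb]; linarith
    refine (norm_add_le _ _).trans ?_
    rw [norm_smul, norm_smul]
    have := mul_le_mul hs e1 (norm_nonneg _) zero_le_one
    have := mul_le_mul hc e2 (norm_nonneg _) zero_le_one
    linarith
  · filter_upwards [ae_mem_sphere n] with x hx t _
    have hd : DifferentiableAt ℝ g (planeRotation a b t x) :=
      (hg.contDiffAt (isOpen_compl_singleton.mem_nhds (hsub (hmaps t hx)))).differentiableAt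
        one_ne_zero
    exact hd.hasFDerivAt.comp_hasDerivAt t (hasDerivAt_planeRotation a b x t)

/-- The divergence theorem for positively `1`-homogeneous vector fields on the sphere. -/
lemma integral_divergence_sphereH {n : ℕ} (hn : n ≠ 0) (W : Fin n → E n → ℝ)
    (hW : ∀ j, ContDiffOn ℝ 1 (W j) {(0 : E n)}ᶜ) (hhom : ∀ j, homog1 (W j)) :
    ∫ x, ∑ j, fderiv ℝ (W j) x (stdE n j) ∂sphereH n =
      n * ∫ x, ∑ j, x j * W j x ∂sphereH n := by
  have hdiff : ∀ j, ∀ x ∈ sphere (0 : E n) 1, DifferentiableAt ℝ (W j) x := fun j x hx =>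
    ((hW j).contDiffAt (isOpen_compl_singleton.mem_nhds
      (sphere_subset_compl_zero n hx))).differentiableAt one_ne_zero
  have hWc : ∀ j, ContinuousOn (W j) (sphere (0 : E n) 1) := fun j =>
    (hW j).continuousOn.mono (sphere_subset_compl_zero n)
  have hWd : ∀ j, ContinuousOn (fderiv ℝ (W j)) (sphere (0 : E n) 1) := fun j =>
    ((hW j).continuousOn_fderiv_of_isOpen isOpen_compl_singleton le_rfl).mono
      (sphere_subset_compl_zero n)
  have hcoord : ∀ i : Fin n, ContDiff ℝ 1 fun x : E n => x i := fun i => by fun_prop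
  have heuler : ∀ j, ∀ x ∈ sphere (0 : E n) 1, fderiv ℝ (W j) x x = W j x :=
    fun j x hx => (hhom j).fderiv_apply_self (hdiff j x hx)
  have hterm : ∀ i j, ∫ x, fderiv ℝ (fun y : E n => y i * W j y) x
      (x i • stdE n j - x j • stdE n i) ∂sphereH n = 0 := by
    intro i j
    by_cases hij : i = j
    · subst hij; simp
    · have := integral_fderiv_rotation hn (a := stdE n i) (b := stdE n j) (by simp) (by simp)
        ((EuclideanSpace.basisFun (Fin n) ℝ).orthonormal.2 hij)
        (g := fun y : E n => y i * W j y) ((hcoord i).contDiffOn.mul (hW j))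
      simpa only [real_inner_comm, inner_stdE] using this
  have hfd : ∀ i j, ∀ x ∈ sphere (0 : E n) 1, ∀ v : E n,
      fderiv ℝ (fun y : E n => y i * W j y) x v = x i * fderiv ℝ (W j) x v + W j x * v i := by
    intro i j x hx v
    have h1 : HasFDerivAt (fun y : E n => y i) (EuclideanSpace.proj i : E n →L[ℝ] ℝ) x :=
      (EuclideanSpace.proj i : E n →L[ℝ] ℝ).hasFDerivAt
    have h2 : HasFDerivAt (fun y : E n => y i * W j y) _ x := h1.mul (hdiff j x hx).hasFDerivAt
    rw [h2.fderiv]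
    simp
  have hpt : ∀ x ∈ sphere (0 : E n) 1, ∑ i, ∑ j, fderiv ℝ (fun y : E n => y i * W j y) x
      (x i • stdE n j - x j • stdE n i) =
      ∑ j, fderiv ℝ (W j) x (stdE n j) - n * ∑ j, x j * W j x := by
    intro x hx
    have hx1 : ‖x‖ = 1 := by simpa using hx
    have hstd : ∀ i j, stdE n j i = if i = j then 1 else 0 := fun i j => by
      simp [stdE]
    have : ∀ i j, fderiv ℝ (fun y : E n => y i * W j y) x (x i • stdE n j - x j • stdE n i) =
        x i * x i * fderiv ℝ (W j) x (stdE n j) - x j * fderiv ℝ (W j) x (x i • stdE n i)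
          + ((if i = j then x i * W j x else 0) - x j * W j x) := by
      intro i j
      rw [hfd i j x hx]
      simp only [map_sub, map_smul, PiLp.sub_apply, PiLp.smul_apply, hstd, smul_eq_mul]
      split_ifs <;> simp <;> ring
    simp only [this, Finset.sum_add_distrib, Finset.sum_sub_distrib]
    have e1 : ∑ i, ∑ j, x i * x i * fderiv ℝ (W j) x (stdE n j) =
        ∑ j, fderiv ℝ (W j) x (stdE n j) := by
      rw [← Finset.sum_mul_sum, sum_sq_eq_one hx1, one_mul]
    have e2 : ∑ i, ∑ j, x j * fderiv ℝ (W j) x (x i • stdE n i) = ∑ j, x j * W j x := by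
      rw [Finset.sum_comm]
      refine Finset.sum_congr rfl fun j _ => ?_
      rw [← Finset.mul_sum, ← map_sum, sum_smul_stdE, heuler j x hx]
    rw [e1, e2]
    simp
  have hint : ∀ i j, Integrable (fun x => fderiv ℝ (fun y : E n => y i * W j y) x
      (x i • stdE n j - x j • stdE n i)) (sphereH n) := by
    intro i j
    refine integrable_sphereH hn (ContinuousOn.clm_apply ?_ (by fun_prop))
    exact ((((hcoord i).contDiffOn.mul (hW j)).continuousOn_fderiv_of_isOpen
      isOpen_compl_singleton le_rfl).mono (sphere_subset_compl_zero n))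
  have hsum : ∫ x, ∑ i, ∑ j, fderiv ℝ (fun y : E n => y i * W j y) x
      (x i • stdE n j - x j • stdE n i) ∂sphereH n = 0 := by
    rw [integral_finsetSum _ fun i _ => integrable_finsetSum _ fun j _ => hint i j]
    refine Finset.sum_eq_zero fun i _ => ?_
    rw [integral_finsetSum _ fun j _ => hint i j]
    exact Finset.sum_eq_zero fun j _ => hterm i j
  rw [integral_congr_ae ((ae_mem_sphere n).mono hpt), integral_sub, integral_const_mul] at hsum
  · linarith
  · exact integrable_finsetSum _ fun j _ => integrable_sphereH hn
      ((hWd j).clm_apply continuousOn_const)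
  · refine (integrable_finsetSum _ fun j _ => integrable_sphereH hn
      (ContinuousOn.mul (by fun_prop) (hWc j))).const_mul _

/-- The components of the vector field `adj(DZ) V`, given by Cramer's rule. -/
def cofactorField {n : ℕ} (Z V : E n → E n) (j : Fin n) (x : E n) : ℝ :=
  detC n (update (fun i => fderiv ℝ Z x (stdE n i)) j (V x))

lemma contDiffOn_cofactorField {n : ℕ} {Z V : E n → E n} {s : Set (E n)} (hs : IsOpen s)
    (hZ : ContDiffOn ℝ 2 Z s) (hV : ContDiffOn ℝ 1 V s) (j : Fin n) :
    ContDiffOn ℝ 1 (cofactorField Z V j) s := by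
  refine (detC n).toContinuousMultilinearMap.contDiff.comp_contDiffOn (contDiffOn_pi.2 fun i => ?_)
  by_cases h : i = j
  · subst h; simpa using hV
  · simp only [update_of_ne h]
    exact (hZ.fderiv_of_isOpen hs (by norm_num)).clm_apply contDiffOn_const

lemma fderiv_cofactorField {n : ℕ} {Z V : E n → E n} {x : E n}
    (hZ : DifferentiableAt ℝ (fderiv ℝ Z) x) (hV : DifferentiableAt ℝ V x) (j : Fin n) (w : E n) :
    fderiv ℝ (cofactorField Z V j) x w =
      detC n (update (fun i => fderiv ℝ Z x (stdE n i)) j (fderiv ℝ V x w)) +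
      ∑ k, if k = j then 0 else
        detC n (update (update (fun i => fderiv ℝ Z x (stdE n i)) j (V x)) k
          (fderiv ℝ (fderiv ℝ Z) x w (stdE n k))) := by
  have hv : HasFDerivAt (fun y => update (fun i => fderiv ℝ Z y (stdE n i)) j (V y))
      (ContinuousLinearMap.pi fun i => if i = j then fderiv ℝ V x else
        (fderiv ℝ (fderiv ℝ Z) x).flip (stdE n i)) x := by
    rw [hasFDerivAt_pi]
    intro i
    by_cases h : i = j
    · subst h; simpa using hV.hasFDerivAt
    · simp only [update_of_ne h, h, if_false]
      have := hZ.hasFDerivAt.clm_apply (hasFDerivAt_const (stdE n i) x)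
      simpa using this
  have h2 : HasFDerivAt (cofactorField Z V j) _ x := ((detC n).hasFDerivAt _).comp x hv
  rw [h2.fderiv, ContinuousLinearMap.comp_apply]
  change (detC n).toContinuousMultilinearMap.linearDeriv _ _ = _
  rw [ContinuousMultilinearMap.linearDeriv_apply, ← Finset.add_sum_erase _ _ (Finset.mem_univ j),
    ← Finset.add_sum_erase (a := j) (f := fun k => if k = j then (0 : ℝ) else _) _
      (Finset.mem_univ j)]
  simp only [ContinuousLinearMap.coe_pi', if_true, update_idem, zero_add]
  congr 1
  refine Finset.sum_congr rfl fun k hk => ?_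
  simp only [Finset.ne_of_mem_erase hk, if_false]
  rfl

/-- Piola's identity: the cofactor matrix of a Jacobian is divergence free. -/
lemma sum_fderiv_cofactorField {n : ℕ} {Z V : E n → E n} {x : E n} (hZ : ContDiffAt ℝ 2 Z x)
    (hV : DifferentiableAt ℝ V x) :
    ∑ j, fderiv ℝ (cofactorField Z V j) x (stdE n j) =
      ∑ j, detC n (update (fun i => fderiv ℝ Z x (stdE n i)) j (fderiv ℝ V x (stdE n j))) := by
  have hZ' : DifferentiableAt ℝ (fderiv ℝ Z) x :=
    (hZ.fderiv_right (m := 1) (by norm_num)).differentiableAt one_ne_zero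
  have hsymm : IsSymmSndFDerivAt ℝ Z x := hZ.isSymmSndFDerivAt (by simp)
  simp only [fderiv_cofactorField hZ' hV, Finset.sum_add_distrib]
  rw [add_eq_left]
  set T : Fin n → Fin n → ℝ := fun j k => if k = j then 0 else
    detC n (update (update (fun i => fderiv ℝ Z x (stdE n i)) j (V x)) k
      (fderiv ℝ (fderiv ℝ Z) x (stdE n j) (stdE n k))) with hT
  have hanti : ∀ j k, T k j = -T j k := by
    intro j k
    by_cases h : j = k
    · simp [hT, h]
    · have h' : k ≠ j := Ne.symm h
      simp only [hT, h, h', if_false]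
      have := (detC n).toAlternatingMap.map_swap
        (update (update (fun i => fderiv ℝ Z x (stdE n i)) j (V x)) k
          (fderiv ℝ (fderiv ℝ Z) x (stdE n j) (stdE n k))) h
      refine Eq.trans ?_ this
      rw [hsymm (stdE n j) (stdE n k)]
      change detC n _ = detC n _
      congr 1
      ext1 i
      by_cases hi : i = j
      · subst hi; simp
      · by_cases hi' : i = k
        · subst hi'; simp [h, h']
        · simp [hi, hi', Equiv.swap_apply_of_ne_of_ne hi hi']
  have h1 : ∑ j, ∑ k, T j k = -∑ j, ∑ k, T j k := by
    calc ∑ j, ∑ k, T j k = ∑ k, ∑ j, T j k := Finset.sum_comm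
      _ = ∑ k, ∑ j, -T k j :=
        Finset.sum_congr rfl fun k _ => Finset.sum_congr rfl fun j _ => hanti k j
      _ = -∑ j, ∑ k, T j k := by simp only [Finset.sum_neg_distrib]
  exact self_eq_neg.1 h1

/-- The positively `1`-homogeneous extension of the restriction of `X` to the unit sphere. -/
def homogExt {n : ℕ} (X : E n → E n) (x : E n) : E n := ‖x‖ • X (‖x‖⁻¹ • x)

lemma homogExt_smul {n : ℕ} (X : E n → E n) {t : ℝ} (ht : 0 < t) (x : E n) :
    homogExt X (t • x) = t • homogExt X x := by
  rw [homogExt, homogExt, norm_smul, Real.norm_of_nonneg ht.le, smul_smul, smul_smul]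
  congr 3
  field_simp

lemma homogExt_of_norm_eq_one {n : ℕ} (X : E n → E n) {u : E n} (hu : ‖u‖ = 1) :
    homogExt X u = X u := by
  simp [homogExt, hu]

lemma contDiffOn_homogExt {n : ℕ} {m : WithTop ℕ∞} {X : E n → E n}
    (hX : ContDiffOn ℝ m X {(0 : E n)}ᶜ) : ContDiffOn ℝ m (homogExt X) {(0 : E n)}ᶜ := by
  have hnorm : ContDiffOn ℝ m (fun x : E n => ‖x‖) {(0 : E n)}ᶜ := fun x hx =>
    (contDiffAt_norm ℝ hx).contDiffWithinAt
  refine hnorm.smul (hX.comp ((hnorm.inv fun x hx => norm_ne_zero_iff.2 hx).smul contDiffOn_id) ?_)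
  intro x hx
  have hx' : x ≠ 0 := hx
  simp [hx']

lemma fderiv_homogExt {n : ℕ} {X : E n → E n} {u : E n} (hu : ‖u‖ = 1)
    (hX : DifferentiableAt ℝ X u) :
    fderiv ℝ (homogExt X) u = replaceNormal (fderiv ℝ X u) (X u) u := by
  have hu0 : u ≠ 0 := by rintro rfl; simp at hu
  have hnorm : HasFDerivAt (fun x : E n => ‖x‖) (innerSL ℝ u) u := by
    have h := (hasStrictFDerivAt_norm_sq u).hasFDerivAt.sqrt (by simp [hu])
    simp only [Real.sqrt_sq (norm_nonneg _)] at h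
    refine h.congr_fderiv ?_
    ext1 v
    simp [hu]
  have hinv : HasFDerivAt (fun x : E n => ‖x‖⁻¹) (-innerSL ℝ u) u := by
    refine ((hasDerivAt_inv (norm_ne_zero_iff.2 hu0)).comp_hasFDerivAt u hnorm).congr_fderiv ?_
    simp [hu]
  have hr : HasFDerivAt (fun x : E n => ‖x‖⁻¹ • x) (tproj u) u := by
    have := hinv.smul (hasFDerivAt_id u)
    refine this.congr_fderiv ?_
    ext1 v
    simp [hu, tproj_apply, sub_eq_add_neg]
  have hX' : HasFDerivAt X (fderiv ℝ X u) (‖u‖⁻¹ • u) := by simpa [hu] using hX.hasFDerivAt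
  have h := hnorm.smul (hX'.comp (f := fun x => ‖x‖⁻¹ • x) u hr)
  have h' : HasFDerivAt (homogExt X) _ u := h
  rw [h'.fderiv]
  ext1 v
  simp [hu, replaceNormal]

lemma fderiv_smul_of_homog {n : ℕ} {Z : E n → E n}
    (hZ : ∀ t : ℝ, 0 < t → ∀ x, Z (t • x) = t • Z x) {t : ℝ} (ht : 0 < t) (x : E n) :
    fderiv ℝ Z (t • x) = fderiv ℝ Z x := by
  have h1 : fderiv ℝ (fun y => Z (t • y)) x = t • fderiv ℝ Z (t • x) := fderiv_comp_smul t
  have h2 : fderiv ℝ (fun y => Z (t • y)) x = t • fderiv ℝ Z x := by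
    have : (fun y => Z (t • y)) = t • Z := by ext1 y; exact hZ t ht y
    rw [this, fderiv_const_smul_field, Pi.smul_apply]
  exact smul_right_injective _ ht.ne' (h1.symm.trans h2)

/-- The integrated Piola identity on the sphere, for smooth maps. -/
lemma integral_replaceNormal_of_contDiffOn_two {n : ℕ} (hn : n ≠ 0) {X Y : E n → E n}
    (hX : ContDiffOn ℝ 2 X {(0 : E n)}ᶜ) (hY : ContDiffOn ℝ 1 Y {(0 : E n)}ᶜ) :
    ∫ u, ∑ j, detC n (update (fun i => replaceNormal (fderiv ℝ X u) (X u) u (stdE n i)) j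
        (replaceNormal (fderiv ℝ Y u) (Y u) u (stdE n j))) ∂sphereH n =
      n * ∫ u, detC n (fun i => replaceNormal (fderiv ℝ X u) (Y u) u (stdE n i)) ∂sphereH n := by
  have hZ := contDiffOn_homogExt hX
  have hV := contDiffOn_homogExt hY
  have hnhds : ∀ u ∈ sphere (0 : E n) 1, {(0 : E n)}ᶜ ∈ 𝓝 u := fun u hu =>
    isOpen_compl_singleton.mem_nhds (sphere_subset_compl_zero n hu)
  have hXd : ∀ u ∈ sphere (0 : E n) 1, DifferentiableAt ℝ X u := fun u hu =>
    (hX.contDiffAt (hnhds u hu)).differentiableAt two_ne_zero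
  have hYd : ∀ u ∈ sphere (0 : E n) 1, DifferentiableAt ℝ Y u := fun u hu =>
    (hY.contDiffAt (hnhds u hu)).differentiableAt one_ne_zero
  have key := integral_divergence_sphereH hn (cofactorField (homogExt X) (homogExt Y))
    (contDiffOn_cofactorField isOpen_compl_singleton hZ hV) fun j t ht x => by
      rw [cofactorField, cofactorField, homogExt_smul Y ht,
        ContinuousAlternatingMap.map_update_smul,
        fderiv_smul_of_homog (fun s hs y => homogExt_smul X hs y) ht, smul_eq_mul]
  refine Eq.trans (integral_congr_ae ?_) (key.trans ?_)
  · filter_upwards [ae_mem_sphere n] with u hu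
    have hu1 : ‖u‖ = 1 := by simpa using hu
    rw [sum_fderiv_cofactorField (hZ.contDiffAt (hnhds u hu))
      ((hV.contDiffAt (hnhds u hu)).differentiableAt one_ne_zero),
      fderiv_homogExt hu1 (hXd u hu), fderiv_homogExt hu1 (hYd u hu)]
  · congr 1
    refine integral_congr_ae ?_
    filter_upwards [ae_mem_sphere n] with u hu
    have hu1 : ‖u‖ = 1 := by simpa using hu
    simp only [cofactorField]
    rw [fderiv_homogExt hu1 (hXd u hu), homogExt_of_norm_eq_one Y hu1,
      ← detC_replaceNormal _ _ hu1, replaceNormal_replaceNormal _ _ _ hu1]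

/-- Smoothing a compactly supported `C¹` map by convolution. -/
lemma exists_contDiff_two_dist_le {n : ℕ} {X : E n → E n} (hX : ContDiff ℝ 1 X)
    (hc : HasCompactSupport X) {δ : ℝ} (hδ : 0 < δ) :
    ∃ Y : E n → E n, ContDiff ℝ 2 Y ∧
      ∀ x, dist (Y x) (X x) ≤ δ ∧ dist (fderiv ℝ Y x) (fderiv ℝ X x) ≤ δ := by
  have hX' : Continuous (fderiv ℝ X) := hX.continuous_fderiv one_ne_zero
  obtain ⟨r₁, hr₁, h₁⟩ := Metric.uniformContinuous_iff.1
    (hc.uniformContinuous_of_continuous hX.continuous) δ hδ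
  obtain ⟨r₂, hr₂, h₂⟩ := Metric.uniformContinuous_iff.1
    ((hc.fderiv ℝ).uniformContinuous_of_continuous hX') δ hδ
  have hr : 0 < min r₁ r₂ := lt_min hr₁ hr₂
  let ρ : ContDiffBump (0 : E n) := ⟨min r₁ r₂ / 2, min r₁ r₂, half_pos hr, half_lt_self hr⟩
  have hloc : LocallyIntegrable (ρ.normed volume) :=
    ρ.continuous_normed.locallyIntegrable
  have hderiv : ∀ x, HasFDerivAt
      (convolution (ρ.normed volume) X (ContinuousLinearMap.lsmul ℝ ℝ) volume)
      (convolution (ρ.normed volume) (fderiv ℝ X) (ContinuousLinearMap.lsmul ℝ ℝ) volume x) x := by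
    intro x
    have h := hc.hasFDerivAt_convolution_right (ContinuousLinearMap.lsmul ℝ ℝ) hloc hX x
    have hL : (ContinuousLinearMap.lsmul ℝ ℝ : ℝ →L[ℝ] E n →L[ℝ] E n).precompR (E n) =
        ContinuousLinearMap.lsmul ℝ ℝ := by
      ext; simp
    rwa [hL] at h
  refine ⟨convolution (ρ.normed volume) X (ContinuousLinearMap.lsmul ℝ ℝ) volume,
    ρ.hasCompactSupport_normed.contDiff_convolution_left _ ρ.contDiff_normed
      hX.continuous.locallyIntegrable, fun x => ⟨?_, ?_⟩⟩
  · refine ρ.dist_normed_convolution_le hX.continuous.aestronglyMeasurable fun y hy => ?_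
    exact (h₁ (lt_of_lt_of_le (mem_ball.1 hy) (min_le_left _ _))).le
  · rw [(hderiv x).fderiv]
    refine ρ.dist_normed_convolution_le hX'.aestronglyMeasurable fun y hy => ?_
    exact (h₂ (lt_of_lt_of_le (mem_ball.1 hy) (min_le_right _ _))).le

lemma exists_hasCompactSupport_eventuallyEq {n : ℕ} {X : E n → E n}
    (hX : ContDiffOn ℝ 1 X {(0 : E n)}ᶜ) :
    ∃ Y : E n → E n, ContDiff ℝ 1 Y ∧ HasCompactSupport Y ∧
      ∀ u ∈ sphere (0 : E n) 1, Y =ᶠ[𝓝 u] X := by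
  let β : ContDiffBump (0 : E n) := ⟨1 / 4, 1 / 2, by norm_num, by norm_num⟩
  let γ : ContDiffBump (0 : E n) := ⟨2, 3, by norm_num, by norm_num⟩
  refine ⟨fun x => ((1 - β x) * γ x) • X x, contDiff_iff_contDiffAt.2 fun x => ?_, ?_, ?_⟩
  · by_cases hx : x = 0
    · subst hx
      have : (fun x => ((1 - β x) * γ x) • X x) =ᶠ[𝓝 0] fun _ => 0 := by
        filter_upwards [closedBall_mem_nhds (0 : E n) β.rIn_pos] with y hy
        simp [β.one_of_mem_closedBall hy]
      exact contDiffAt_const.congr_of_eventuallyEq this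
    · exact ((contDiffAt_const.sub β.contDiffAt).mul γ.contDiffAt).smul
        (hX.contDiffAt (isOpen_compl_singleton.mem_nhds hx))
  · exact (γ.hasCompactSupport.mul_left (f := fun x => 1 - β x)).smul_right
  · intro u hu
    have hu1 : ‖u‖ = 1 := by simpa using hu
    have hβ : {x : E n | (1 / 2 : ℝ) < ‖x‖} ∈ 𝓝 u :=
      (isOpen_lt continuous_const continuous_norm).mem_nhds (by simp [hu1]; norm_num)
    have hγ : {x : E n | ‖x‖ < 2} ∈ 𝓝 u :=
      (isOpen_lt continuous_norm continuous_const).mem_nhds (by simp [hu1])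
    filter_upwards [hβ, hγ] with x hx hx'
    have h1 : β x = 0 := β.zero_of_le_dist (by rw [dist_zero_right]; exact le_of_lt hx)
    have h2 : γ x = 1 := γ.one_of_mem_closedBall (by simpa using (le_of_lt hx' : ‖x‖ ≤ 2))
    simp [h1, h2]

/-- Near the sphere, a `C¹` map is a `C¹`-uniform limit of `C²` maps. -/
lemma exists_seq_contDiff_two {n : ℕ} {X : E n → E n} (hX : ContDiffOn ℝ 1 X {(0 : E n)}ᶜ) :
    ∃ Y : ℕ → E n → E n, (∀ k, ContDiff ℝ 2 (Y k)) ∧ ∀ k, ∀ u ∈ sphere (0 : E n) 1,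
      dist (Y k u, fderiv ℝ (Y k) u) (X u, fderiv ℝ X u) ≤ 1 / ((k : ℝ) + 1) := by
  obtain ⟨X', hX', hc, heq⟩ := exists_hasCompactSupport_eventuallyEq hX
  choose Y hY hd using fun k : ℕ =>
    exists_contDiff_two_dist_le hX' hc (Nat.one_div_pos_of_nat (α := ℝ) (n := k))
  refine ⟨Y, hY, fun k u hu => ?_⟩
  rw [← (heq u hu).eq_of_nhds, ← (heq u hu).fderiv_eq, Prod.dist_eq]
  exact max_le (hd k u).1 (hd k u).2

/-- Convergence of integrals over the sphere of continuous functions of uniformly convergent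
data. -/
lemma tendsto_integral_sphereH {n : ℕ} (hn : n ≠ 0) {F : Type*} [NormedAddCommGroup F]
    [NormedSpace ℝ F] [FiniteDimensional ℝ F] {G : F × E n → ℝ}
    (hG : ContinuousOn G (Set.univ ×ˢ sphere (0 : E n) 1)) {z : ℕ → E n → F} {z₀ : E n → F}
    (hz : ∀ k, ContinuousOn (z k) (sphere (0 : E n) 1))
    (hz₀ : ContinuousOn z₀ (sphere (0 : E n) 1))
    (hd : ∀ k, ∀ u ∈ sphere (0 : E n) 1, dist (z k u) (z₀ u) ≤ 1 / ((k : ℝ) + 1)) :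
    Tendsto (fun k => ∫ u, G (z k u, u) ∂sphereH n) atTop
      (𝓝 (∫ u, G (z₀ u, u) ∂sphereH n)) := by
  have hfin := isFiniteMeasure_sphereH hn
  have : ProperSpace F := FiniteDimensional.proper_real F
  obtain ⟨R, hR⟩ := (isCompact_sphere (0 : E n) 1).exists_bound_of_continuousOn hz₀
  obtain ⟨C, hC⟩ := ((isCompact_closedBall (0 : F) (R + 1)).prod
    (isCompact_sphere (0 : E n) 1)).exists_bound_of_continuousOn
    (hG.mono (Set.prod_mono (Set.subset_univ _) subset_rfl))
  refine tendsto_integral_of_dominated_convergence (fun _ => C) (fun k => ?_)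
    (integrable_const C) (fun k => ?_) ?_
  · exact aestronglyMeasurable_sphereH
      (hG.comp ((hz k).prodMk continuousOn_id) fun u hu => ⟨Set.mem_univ _, hu⟩)
  · filter_upwards [ae_mem_sphere n] with u hu
    refine hC _ ⟨mem_closedBall_zero_iff.2 ?_, hu⟩
    have h1 : ‖z k u‖ ≤ ‖z₀ u‖ + dist (z k u) (z₀ u) := by
      rw [dist_eq_norm]; exact norm_le_norm_add_norm_sub' _ _
    have h2 : 1 / ((k : ℝ) + 1) ≤ 1 := by
      rw [div_le_one (by positivity)]; linarith [Nat.cast_nonneg (α := ℝ) k]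
    linarith [hR u hu, hd k u hu]
  · filter_upwards [ae_mem_sphere n] with u hu
    have hlim : Tendsto (fun k => z k u) atTop (𝓝 (z₀ u)) :=
      tendsto_iff_dist_tendsto_zero.2 (squeeze_zero (fun _ => dist_nonneg) (fun k => hd k u hu)
        tendsto_one_div_add_atTop_nhds_zero_nat)
    have hcont := hG (z₀ u, u) ⟨Set.mem_univ _, hu⟩
    refine hcont.tendsto.comp (tendsto_nhdsWithin_iff.2 ⟨hlim.prodMk_nhds tendsto_const_nhds, ?_⟩)
    exact Eventually.of_forall fun k => ⟨Set.mem_univ _, hu⟩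

lemma continuousOn_detC {n : ℕ} {α : Type*} [TopologicalSpace α] {s : Set α}
    {v : Fin n → α → E n} (hv : ∀ i, ContinuousOn (v i) s) :
    ContinuousOn (fun a => detC n fun i => v i a) s :=
  (detC n).cont.comp_continuousOn (continuousOn_pi.2 hv)

lemma continuousOn_detC_update {n : ℕ} {α : Type*} [TopologicalSpace α] {s : Set α}
    {v : Fin n → α → E n} {w : α → E n} (hv : ∀ i, ContinuousOn (v i) s) (hw : ContinuousOn w s)
    (j : Fin n) : ContinuousOn (fun a => detC n (update (fun i => v i a) j (w a))) s := by
  refine (detC n).cont.comp_continuousOn (continuousOn_pi.2 fun i => ?_)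
  by_cases h : i = j
  · subst h; simpa using hw
  · simpa [h] using hv i

lemma continuousOn_replaceNormal {n : ℕ} {α : Type*} [TopologicalSpace α] {s : Set α}
    {L : α → E n →L[ℝ] E n} {p u : α → E n} (hL : ContinuousOn L s) (hp : ContinuousOn p s)
    (hu : ContinuousOn u s) (v : E n) :
    ContinuousOn (fun a => replaceNormal (L a) (p a) (u a) v) s := by
  simp only [replaceNormal_apply]
  have hi : ContinuousOn (fun a => ⟪u a, v⟫) s := hu.inner continuousOn_const
  exact (hL.clm_apply (continuousOn_const.sub (hi.smul hu))).add (hi.smul hp)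

/-- The integrated Piola identity on the sphere. -/
lemma integral_replaceNormal {n : ℕ} (hn : n ≠ 0) {X Y : E n → E n}
    (hX : ContDiffOn ℝ 1 X {(0 : E n)}ᶜ) (hY : ContDiffOn ℝ 1 Y {(0 : E n)}ᶜ) :
    ∫ u, ∑ j, detC n (update (fun i => replaceNormal (fderiv ℝ X u) (X u) u (stdE n i)) j
        (replaceNormal (fderiv ℝ Y u) (Y u) u (stdE n j))) ∂sphereH n =
      n * ∫ u, detC n (fun i => replaceNormal (fderiv ℝ X u) (Y u) u (stdE n i)) ∂sphereH n := by
  have hsub := sphere_subset_compl_zero n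
  have hfd : ∀ {X : E n → E n}, ContDiffOn ℝ 1 X {(0 : E n)}ᶜ →
      ContinuousOn (fderiv ℝ X) (sphere (0 : E n) 1) := fun h =>
    (h.continuousOn_fderiv_of_isOpen isOpen_compl_singleton le_rfl).mono hsub
  obtain ⟨Xk, hXk, hd⟩ := exists_seq_contDiff_two hX
  have hz₀ : ContinuousOn (fun u => (X u, fderiv ℝ X u)) (sphere (0 : E n) 1) :=
    (hX.continuousOn.mono hsub).prodMk (hfd hX)
  have hz : ∀ k, ContinuousOn (fun u => (Xk k u, fderiv ℝ (Xk k) u)) (sphere (0 : E n) 1) :=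
    fun k => (hXk k).continuous.continuousOn.prodMk
      ((hXk k).continuous_fderiv two_ne_zero).continuousOn
  have hYs : ∀ {f : E n → E n}, ContinuousOn f (sphere (0 : E n) 1) →
      ContinuousOn (fun a : (E n × (E n →L[ℝ] E n)) × E n => f a.2)
        (Set.univ ×ˢ sphere (0 : E n) 1) := fun h =>
    h.comp continuousOn_snd fun a ha => ha.2
  have hG : ContinuousOn (fun a : (E n × (E n →L[ℝ] E n)) × E n =>
      ∑ j, detC n (update (fun i => replaceNormal a.1.2 a.1.1 a.2 (stdE n i)) j
        (replaceNormal (fderiv ℝ Y a.2) (Y a.2) a.2 (stdE n j))))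
      (Set.univ ×ˢ sphere (0 : E n) 1) := by
    refine continuousOn_finsetSum _ fun j _ => continuousOn_detC_update (fun i => ?_) ?_ j
    · exact continuousOn_replaceNormal (by fun_prop) (by fun_prop) (by fun_prop) _
    · exact continuousOn_replaceNormal ((hfd hY).comp continuousOn_snd fun a ha => ha.2)
        (hYs (hY.continuousOn.mono hsub)) (by fun_prop) _
  have hG' : ContinuousOn (fun a : (E n × (E n →L[ℝ] E n)) × E n =>
      detC n (fun i => replaceNormal a.1.2 (Y a.2) a.2 (stdE n i)))
      (Set.univ ×ˢ sphere (0 : E n) 1) :=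
    continuousOn_detC fun i => continuousOn_replaceNormal (by fun_prop)
      (hYs (hY.continuousOn.mono hsub)) (by fun_prop) _
  have h1 := tendsto_integral_sphereH hn hG hz hz₀ hd
  have h2 := (tendsto_integral_sphereH hn hG' hz hz₀ hd).const_mul (n : ℝ)
  refine tendsto_nhds_unique h1 (h2.congr fun k => ?_)
  exact (integral_replaceNormal_of_contDiffOn_two hn (hXk k).contDiffOn hY).symm

lemma contDiffOn_gradient {n : ℕ} {g : E n → ℝ} (hg : ContDiffOn ℝ 2 g {(0 : E n)}ᶜ) :
    ContDiffOn ℝ 1 (gradient g) {(0 : E n)}ᶜ :=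
  (InnerProductSpace.toDual ℝ (E n)).symm.toContinuousLinearEquiv.contDiff.comp_contDiffOn
    (hg.fderiv_of_isOpen isOpen_compl_singleton (by norm_num))

lemma homog1.inner_gradient_self {n : ℕ} {g : E n → ℝ} (hg : homog1 g) {x : E n}
    (hd : DifferentiableAt ℝ g x) : ⟪gradient g x, x⟫ = g x := by
  rw [inner_gradient_left, hg.fderiv_apply_self hd]

/-- The second derivative of a `1`-homogeneous function at `u` has range in `u^⊥`. -/
lemma homog1.inner_sHess_self {n : ℕ} {g : E n → ℝ} (hg : homog1 g)
    (hc : ContDiffOn ℝ 2 g {(0 : E n)}ᶜ) {u : E n} (hu : u ≠ 0) (v : E n) :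
    ⟪sHess g u v, u⟫ = 0 := by
  have hd : ∀ x : E n, x ≠ 0 → DifferentiableAt ℝ g x := fun x hx =>
    (hc.contDiffAt (isOpen_compl_singleton.mem_nhds hx)).differentiableAt two_ne_zero
  have hgrad : HasFDerivAt (gradient g) (sHess g u) u :=
    (((contDiffOn_gradient hc).contDiffAt
      (isOpen_compl_singleton.mem_nhds hu)).differentiableAt one_ne_zero).hasFDerivAt
  have h1 := hgrad.inner ℝ (hasFDerivAt_id u)
  have h2 : g =ᶠ[𝓝 u] fun x => ⟪gradient g x, id x⟫ := by
    filter_upwards [isOpen_compl_singleton.mem_nhds hu] with x hx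
    exact (hg.inner_gradient_self (hd x hx)).symm
  have h3 := congrArg (· v) (((hd u hu).hasFDerivAt.congr_of_eventuallyEq h2.symm).unique h1)
  simp only [ContinuousLinearMap.comp_apply, ContinuousLinearMap.prod_apply,
    fderivInnerCLM_apply, ContinuousLinearMap.id_apply, id_eq, inner_gradient_left] at h3
  linarith

lemma inner_mul_sdet {n : ℕ} {g : E n → ℝ} (hg : homog1 g)
    (hc : ContDiffOn ℝ 2 g {(0 : E n)}ᶜ) {u : E n} (hu : u ∈ sphere (0 : E n) 1) (p : E n) :
    ⟪p, u⟫ * sdet g u = detC n (fun i => replaceNormal (sHess g u) p u (stdE n i)) := by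
  rw [detC_comp_stdE, det_replaceNormal _ _ (by simpa using hu)
    (hg.inner_sHess_self hc (sphere_subset_compl_zero n hu)), sdet]

lemma gradient_add_mul {n : ℕ} {h φ : E n → ℝ} {x : E n} (hh : DifferentiableAt ℝ h x)
    (hφ : DifferentiableAt ℝ φ x) (s : ℝ) :
    gradient (fun x => h x + s * φ x) x = gradient h x + s • gradient φ x := by
  have := hh.hasGradientAt.hasFDerivAt.add (hφ.hasGradientAt.hasFDerivAt.const_mul s)
  refine HasGradientAt.gradient (hasGradientAt_iff_hasFDerivAt.2 (this.congr_fderiv ?_))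
  simp

lemma sHess_add_mul {n : ℕ} {h φ : E n → ℝ} (hh : ContDiffOn ℝ 2 h {(0 : E n)}ᶜ)
    (hφ : ContDiffOn ℝ 2 φ {(0 : E n)}ᶜ) {u : E n} (hu : u ≠ 0) (s : ℝ) :
    sHess (fun x => h x + s * φ x) u = sHess h u + s • sHess φ u := by
  have hnhds := isOpen_compl_singleton.mem_nhds hu
  have heq : gradient (fun x => h x + s * φ x) =ᶠ[𝓝 u]
      fun x => gradient h x + s • gradient φ x := by
    filter_upwards [hnhds] with x hx
    have hx' := isOpen_compl_singleton.mem_nhds hx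
    exact gradient_add_mul ((hh.contDiffAt hx').differentiableAt two_ne_zero)
      ((hφ.contDiffAt hx').differentiableAt two_ne_zero) s
  have hg := fun {g : E n → ℝ} (hg : ContDiffOn ℝ 2 g {(0 : E n)}ᶜ) =>
    (((contDiffOn_gradient hg).contDiffAt hnhds).differentiableAt one_ne_zero).hasFDerivAt
  rw [sHess, heq.fderiv_eq]
  exact ((hg hh).add ((hg hφ).const_smul s)).fderiv

lemma homog1.add_mul {n : ℕ} {h φ : E n → ℝ} (hh : homog1 h) (hφ : homog1 φ) (s : ℝ) :
    homog1 fun x => h x + s * φ x := fun t ht x => by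
  change h (t • x) + s * φ (t • x) = t * (h x + s * φ x)
  rw [hh t ht x, hφ t ht x]
  ring

lemma replaceNormal_add_smul {n : ℕ} (L L' : E n →L[ℝ] E n) (p p' u v : E n) (s : ℝ) :
    replaceNormal (L + s • L') (p + s • p') u v =
      replaceNormal L p u v + s • replaceNormal L' p' u v := by
  simp only [replaceNormal_apply, add_apply, smul_apply,
    smul_add, smul_comm s]
  abel

/-- Differentiation under the integral sign of a determinant affine in the parameter. -/
lemma hasDerivAt_integral_detC {n : ℕ} (hn : n ≠ 0) {v w : Fin n → E n → E n}
    (hv : ∀ i, ContinuousOn (v i) (sphere (0 : E n) 1))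
    (hw : ∀ i, ContinuousOn (w i) (sphere (0 : E n) 1)) (s : ℝ) :
    HasDerivAt (fun t : ℝ => ∫ u, detC n (fun i => v i u + t • w i u) ∂sphereH n)
      (∫ u, ∑ j, detC n (update (fun i => v i u + s • w i u) j (w j u)) ∂sphereH n) s := by
  have hfin := isFiniteMeasure_sphereH hn
  have hvw : ∀ t : ℝ, ∀ i, ContinuousOn (fun u => v i u + t • w i u) (sphere (0 : E n) 1) :=
    fun t i => (hv i).add ((hw i).const_smul t)
  have hF : ∀ t : ℝ, ContinuousOn (fun u => detC n (fun i => v i u + t • w i u))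
      (sphere (0 : E n) 1) := fun t => continuousOn_detC (hvw t)
  have hF' : ContinuousOn (fun a : ℝ × E n =>
      ∑ j, detC n (update (fun i => v i a.2 + a.1 • w i a.2) j (w j a.2)))
      (Set.Icc (s - 1) (s + 1) ×ˢ sphere (0 : E n) 1) := by
    have h2 : ∀ {f : E n → E n}, ContinuousOn f (sphere (0 : E n) 1) →
        ContinuousOn (fun a : ℝ × E n => f a.2)
          (Set.Icc (s - 1) (s + 1) ×ˢ sphere (0 : E n) 1) := fun h =>
      h.comp continuousOn_snd fun a ha => ha.2
    exact continuousOn_finsetSum _ fun j _ => continuousOn_detC_update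
      (fun i => (h2 (hv i)).add (continuousOn_fst.smul (h2 (hw i)))) (h2 (hw j)) j
  obtain ⟨C, hC⟩ := (isCompact_Icc.prod (isCompact_sphere (0 : E n) 1)).exists_bound_of_continuousOn
    hF'
  refine (hasDerivAt_integral_of_dominated_loc_of_deriv_le (bound := fun _ => C)
    (F' := fun t u => ∑ j, detC n (update (fun i => v i u + t • w i u) j (w j u)))
    (Icc_mem_nhds (sub_one_lt s) (lt_add_one s))
    (Eventually.of_forall fun t => aestronglyMeasurable_sphereH (hF t))
    (integrable_sphereH hn (hF s)) (aestronglyMeasurable_sphereH ?_) ?_ (integrable_const C) ?_).2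
  · exact continuousOn_finsetSum _ fun j _ => continuousOn_detC_update (hvw s) (hw j) j
  · filter_upwards [ae_mem_sphere n] with u hu t ht using hC (t, u) ⟨ht, hu⟩
  · refine Eventually.of_forall fun u t _ => HasDerivAt.detC_comp (hasDerivAt_pi.2 fun i => ?_)
    simpa using ((hasDerivAt_id t).smul_const (w i u)).const_add (v i u)

/-- Proposition 3.2:  Let `h ∈ 𝒞`, let `φ ∈ C^∞(S^{n-1})` (represented by its smooth
`1`-homogeneous extension) and let `ε > 0` be such that `h + sφ ∈ 𝒞` for every
`s ∈ (-ε, ε)`.  Set `hₛ = h + sφ` and `f(s) = F(hₛ)`.  Then for every `s ∈ (-ε, ε)`,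
`f'(s) = ∫_{S^{n-1}} φ det((hₛ)_ij + hₛ δ_ij) dℋ^{n-1}`. -/
theorem volF_first_variation
    {n : ℕ} (hn : 2 ≤ n) (h φ : E n → ℝ) (hh : memC n h)
    (hφhom : homog1 φ) (hφ : ContDiffOn ℝ (⊤ : ℕ∞) φ {(0 : E n)}ᶜ)
    (ε : ℝ) (hε : 0 < ε)
    (hs : ∀ s ∈ Set.Ioo (-ε) ε, memC n (fun x => h x + s * φ x)) :
    ∀ s ∈ Set.Ioo (-ε) ε,
      HasDerivAt (fun s : ℝ => volF n (fun x => h x + s * φ x))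
        (∫ u in sphere (0 : E n) 1,
          φ u * sdet (fun x => h x + s * φ x) u ∂μH[(n : ℝ) - 1]) s := by
  intro s _
  have hn0 : n ≠ 0 := by omega
  obtain ⟨hhom, hc, -⟩ := hh
  have hφc : ContDiffOn ℝ 2 φ {(0 : E n)}ᶜ := hφ.of_le (WithTop.coe_le_coe.2 (le_top : (2 : ℕ∞) ≤ ⊤))
  have hsub := sphere_subset_compl_zero n
  have hsc : ∀ t : ℝ, ContDiffOn ℝ 2 (fun x => h x + t * φ x) {(0 : E n)}ᶜ := fun t =>
    hc.add (contDiffOn_const.mul hφc)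
  have hdiff : ∀ {g : E n → ℝ}, ContDiffOn ℝ 2 g {(0 : E n)}ᶜ → ∀ u ∈ sphere (0 : E n) 1,
      DifferentiableAt ℝ g u := fun hg u hu =>
    (hg.contDiffAt (isOpen_compl_singleton.mem_nhds (hsub hu))).differentiableAt two_ne_zero
  have hcont : ∀ {g : E n → ℝ}, ContDiffOn ℝ 2 g {(0 : E n)}ᶜ → ∀ i, ContinuousOn
      (fun u => replaceNormal (sHess g u) (gradient g u) u (stdE n i)) (sphere (0 : E n) 1) := by
    intro g hg i
    have hg' := contDiffOn_gradient hg
    exact continuousOn_replaceNormal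
      ((hg'.continuousOn_fderiv_of_isOpen isOpen_compl_singleton le_rfl).mono hsub)
      (hg'.continuousOn.mono hsub) continuousOn_id _
  have hrep : ∀ t : ℝ, ∀ u ∈ sphere (0 : E n) 1, ∀ i,
      replaceNormal (sHess (fun x => h x + t * φ x) u)
        (gradient (fun x => h x + t * φ x) u) u (stdE n i) =
      replaceNormal (sHess h u) (gradient h u) u (stdE n i) +
        t • replaceNormal (sHess φ u) (gradient φ u) u (stdE n i) := fun t u hu i => by
    rw [sHess_add_mul hc hφc (hsub hu), gradient_add_mul (hdiff hc u hu) (hdiff hφc u hu),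
      replaceNormal_add_smul]
  have hvol : ∀ t : ℝ, volF n (fun x => h x + t * φ x) = (1 / n : ℝ) *
      ∫ u, detC n (fun i => replaceNormal (sHess h u) (gradient h u) u (stdE n i) +
        t • replaceNormal (sHess φ u) (gradient φ u) u (stdE n i)) ∂sphereH n := by
    intro t
    refine congrArg ((1 / n : ℝ) * ·) (integral_congr_ae ?_)
    filter_upwards [ae_mem_sphere n] with u hu
    have hst := (hhom.add_mul hφhom t).inner_gradient_self (hdiff (hsc t) u hu)
    rw [← hst, inner_mul_sdet (hhom.add_mul hφhom t) (hsc t) hu]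
    simp only [hrep t u hu]
  have hder := (hasDerivAt_integral_detC hn0 (hcont hc) (hcont hφc) s).const_mul (1 / n : ℝ)
  rw [funext hvol]
  refine hder.congr_deriv ?_
  have h1 : ∫ u, ∑ j, detC n (update
        (fun i => replaceNormal (sHess h u) (gradient h u) u (stdE n i) +
          s • replaceNormal (sHess φ u) (gradient φ u) u (stdE n i)) j
        (replaceNormal (sHess φ u) (gradient φ u) u (stdE n j))) ∂sphereH n =
      n * ∫ u, φ u * sdet (fun x => h x + s * φ x) u ∂sphereH n := by
    refine Eq.trans ?_ ((integral_replaceNormal hn0 (contDiffOn_gradient (hsc s))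
      (contDiffOn_gradient hφc)).trans ?_)
    · refine integral_congr_ae ?_
      filter_upwards [ae_mem_sphere n] with u hu
      simp only [← hrep s u hu]
      rfl
    · refine congrArg ((n : ℝ) * ·) (integral_congr_ae ?_)
      filter_upwards [ae_mem_sphere n] with u hu
      rw [← hφhom.inner_gradient_self (hdiff hφc u hu),
        inner_mul_sdet (hhom.add_mul hφhom s) (hsc s) hu]
      rfl
  rw [h1, one_div, inv_mul_cancel_left₀ (Nat.cast_ne_zero.2 hn0)]
  rfl
end
end
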